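/- arXiv:1002.4059 — 3 statements merged into one kernel-verified Lean document; each statement's English description precedes it below -/
import Mathlib

section
/- There exists an absolute constant C > 0 such that for every function f in the Sobolev space W^{2,1}(ℝ²) (i.e. f and all of its weak partial derivatives up to order 2 are integrable on ℝ²), the Fourier transform of f is integrable and satisfies ‖f̂‖_{L¹(ℝ²)} ≤ C ‖f‖_{W^{2,1}(ℝ²)}. -/
open MeasureTheory Metric Set
open scoped RealInnerProductSpace

noncomputable section

abbrev E2 : Type := EuclideanSpace ℝ (Fin 2)

/-- The Fourier transform `f̂ ξ = ∫ f x e^{-i ξ·x} dx` of a function on the plane. -/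
def fourierT (f : E2 → ℂ) (ξ : E2) : ℂ :=
  ∫ x, Complex.exp (-(Complex.I * (⟪ξ, x⟫ : ℝ))) * f x

/-- `g` is the weak partial derivative of `f` in the direction of the `i`-th coordinate:
integration by parts against smooth compactly supported test functions. -/
def IsWeakPartialDerivC (i : Fin 2) (f g : E2 → ℂ) : Prop :=
  ∀ φ : E2 → ℝ, ContDiff ℝ (⊤ : ℕ∞) φ → HasCompactSupport φ →
    ∫ x, f x * (fderiv ℝ φ x (EuclideanSpace.single i 1) : ℝ) = -∫ x, g x * (φ x : ℝ)

open scoped FourierTransform ENNReal NNReal ContDiff Topology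
open Filter

/-- `L¹` modulus of continuity is controlled by the gradient. -/
lemma translate_le (χ : E2 → ℝ) (hχ : ContDiff ℝ 1 χ) (v : E2) :
    ∫⁻ x, ‖χ (x + v) - χ x‖ₑ ≤ ‖v‖ₑ * ∫⁻ x, ‖fderiv ℝ χ x‖ₑ := by
  have hc : Continuous (fderiv ℝ χ) := hχ.continuous_fderiv one_ne_zero
  have h1 : ∀ x, ‖χ (x + v) - χ x‖ₑ ≤ ∫⁻ r in Ioc (0:ℝ) 1, ‖fderiv ℝ χ (x + r • v)‖ₑ * ‖v‖ₑ := by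
    intro x
    have hd : ∀ r ∈ uIcc (0:ℝ) 1, HasDerivAt (fun r : ℝ => χ (x + r • v))
        (fderiv ℝ χ (x + r • v) v) r := by
      intro r _
      have h2 : HasDerivAt (fun r : ℝ => x + r • v) v r := by
        simpa using ((hasDerivAt_id r).smul_const v).const_add x
      exact ((hχ.differentiable one_ne_zero _).hasFDerivAt).comp_hasDerivAt r h2
    have hcc : Continuous (fun r : ℝ => fderiv ℝ χ (x + r • v) v) := by fun_prop
    have h3 := intervalIntegral.integral_eq_sub_of_hasDerivAt hd (hcc.intervalIntegrable _ _)
    simp only [one_smul, zero_smul, add_zero] at h3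
    rw [← h3, intervalIntegral.integral_of_le zero_le_one]
    refine (enorm_integral_le_lintegral_enorm _).trans (lintegral_mono fun r => ?_)
    exact ContinuousLinearMap.le_opENorm _ _
  calc ∫⁻ x, ‖χ (x + v) - χ x‖ₑ
      ≤ ∫⁻ x, ∫⁻ r in Ioc (0:ℝ) 1, ‖fderiv ℝ χ (x + r • v)‖ₑ * ‖v‖ₑ := lintegral_mono h1
    _ = ∫⁻ r in Ioc (0:ℝ) 1, ∫⁻ x, ‖fderiv ℝ χ (x + r • v)‖ₑ * ‖v‖ₑ := by
        rw [lintegral_lintegral_swap]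
        apply Continuous.aemeasurable
        unfold Function.uncurry
        apply Continuous.comp (g := fun z : ℝ≥0∞ => z * ‖v‖ₑ)
        · exact ENNReal.continuous_mul_const (by simp)
        · exact (hc.comp (by fun_prop)).enorm
    _ = ∫⁻ r in Ioc (0:ℝ) 1, (∫⁻ x, ‖fderiv ℝ χ x‖ₑ) * ‖v‖ₑ := by
        refine lintegral_congr fun r => ?_
        rw [lintegral_mul_const _ (by fun_prop),
          lintegral_add_right_eq_self (fun x => ‖fderiv ℝ χ x‖ₑ)]
    _ = _ := by simp [mul_comm]

/-- Plancherel for differences. -/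
lemma plancherel_diff (χ : E2 → ℝ) (hχ : ContDiff ℝ ∞ χ) (hs : HasCompactSupport χ) (v : E2) :
    ∫⁻ ξ, ‖(Real.fourierChar ⟪v, ξ⟫ : ℂ) - 1‖ₑ ^ 2 * ‖𝓕 (fun x => (χ x : ℂ)) ξ‖ₑ ^ 2
      = ∫⁻ x, ‖χ (x + v) - χ x‖ₑ ^ 2 := by
  have hs1 : HasCompactSupport (fun x => (χ (x + v) : ℂ)) := by
    have h1 : HasCompactSupport (fun x => χ (x + v)) := hs.comp_homeomorph (Homeomorph.addRight v)
    exact h1.comp_left (g := fun t : ℝ => (t : ℂ)) (by simp)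
  have hs0 : HasCompactSupport (fun x => (χ x : ℂ)) := hs.comp_left (g := fun t : ℝ => (t : ℂ)) (by simp)
  have hd0 : ContDiff ℝ ∞ (fun x => (χ x : ℂ)) := Complex.ofRealCLM.contDiff.comp hχ
  have hd1 : ContDiff ℝ ∞ (fun x => (χ (x + v) : ℂ)) := hd0.comp (contDiff_id.add contDiff_const)
  set D : SchwartzMap E2 ℂ := (hs1.sub hs0).toSchwartzMap (hd1.sub hd0) with hD
  have hP := D.integral_norm_sq_fourier
  have hF : ∀ ξ, 𝓕 D ξ = ((Real.fourierChar ⟪v, ξ⟫ : ℂ) - 1) * 𝓕 (fun x => (χ x : ℂ)) ξ := by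
    intro ξ
    have i0 : Integrable (fun x => (χ x : ℂ)) := hd0.continuous.integrable_of_hasCompactSupport hs0
    have i1 : Integrable (fun x => (χ (x + v) : ℂ)) :=
      hd1.continuous.integrable_of_hasCompactSupport hs1
    have e1 : 𝓕 D ξ = 𝓕 (fun x => (χ (x + v) : ℂ) - χ x) ξ := by
      rw [SchwartzMap.fourier_coe]; rfl
    have e2 := congrFun (VectorFourier.fourierIntegral_comp_add_right Real.fourierChar
      (volume : Measure E2) (innerₗ E2) (fun x => (χ x : ℂ)) v) ξ
    have e3 : 𝓕 (fun x => (χ (x + v) : ℂ)) ξ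
        = (Real.fourierChar ⟪v, ξ⟫ : ℂ) * 𝓕 (fun x => (χ x : ℂ)) ξ := e2
    rw [e1, sub_mul, one_mul, ← e3]
    simp only [Real.fourier_eq, smul_sub]
    rw [integral_sub]
    · exact (Real.fourierIntegral_convergent_iff ξ).2 i1
    · exact (Real.fourierIntegral_convergent_iff ξ).2 i0
  have hDi : Integrable (fun x => ‖D x‖ ^ 2) := (D.memLp 2).integrable_norm_pow (by norm_num)
  have hFi : Integrable (fun x => ‖𝓕 D x‖ ^ 2) := ((𝓕 D).memLp 2).integrable_norm_pow (by norm_num)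
  have hP2 := congrArg ENNReal.ofReal hP
  rw [ofReal_integral_eq_lintegral_ofReal hDi (by filter_upwards with x; positivity),
    ofReal_integral_eq_lintegral_ofReal hFi (by filter_upwards with x; positivity)] at hP2
  convert hP2 using 2
  · ext ξ
    rw [hF, norm_mul, mul_pow, ENNReal.ofReal_mul (by positivity), ENNReal.ofReal_pow (by positivity),
      ENNReal.ofReal_pow (by positivity), ofReal_norm, ofReal_norm]
  · ext x
    have : D x = ((χ (x + v) - χ x : ℝ) : ℂ) := by simp [hD]
    rw [this, ENNReal.ofReal_pow (by positivity), ofReal_norm]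
    congr 1
    simp [← ofReal_norm, -Complex.ofReal_sub]

lemma diff_bounds (χ : E2 → ℝ) (hχ : ContDiff ℝ ∞ χ) (h1 : ∀ x, |χ x| ≤ 1) (M : ℝ) (hM : 0 < M)
    (hP : ∫⁻ x, ‖fderiv ℝ χ x‖ₑ ≤ ENNReal.ofReal M)
    (hV : ∫⁻ x, ‖χ x‖ₑ ≤ ENNReal.ofReal (M ^ 2)) (v : E2) :
    ∫⁻ x, ‖χ (x + v) - χ x‖ₑ ^ 2 ≤ ENNReal.ofReal (min (2 * ‖v‖ * M) (4 * M ^ 2)) := by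
  have h2 : ∀ x, ‖χ (x + v) - χ x‖ₑ ^ 2 ≤ 2 * ‖χ (x + v) - χ x‖ₑ := by
    intro x
    rw [sq]
    gcongr
    rw [← ofReal_norm, Real.norm_eq_abs]
    refine ENNReal.ofReal_le_of_le_toReal ?_
    rw [ENNReal.toReal_ofNat]
    have := abs_sub (χ (x+v)) (χ x)
    linarith [h1 (x+v), h1 x]
  have h3 : ∫⁻ x, ‖χ (x + v) - χ x‖ₑ ^ 2 ≤ 2 * ∫⁻ x, ‖χ (x + v) - χ x‖ₑ := by
    rw [← lintegral_const_mul' _ _ (by simp)]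
    exact lintegral_mono h2
  have hc := hχ.continuous
  rw [ENNReal.ofReal_min, le_min_iff]
  constructor
  · refine h3.trans ?_
    rw [ENNReal.ofReal_mul (by positivity), ENNReal.ofReal_mul (by positivity), mul_assoc, ofReal_norm,
      ENNReal.ofReal_ofNat]
    gcongr
    exact (translate_le χ (hχ.of_le (by simp)) v).trans (by gcongr)
  · refine h3.trans ?_
    have : ∫⁻ x, ‖χ (x + v) - χ x‖ₑ ≤ 2 * ENNReal.ofReal (M ^ 2) := by
      calc ∫⁻ x, ‖χ (x + v) - χ x‖ₑ ≤ ∫⁻ x, (‖χ (x + v)‖ₑ + ‖χ x‖ₑ) := lintegral_mono fun x => enorm_sub_le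
        _ = (∫⁻ x, ‖χ (x+v)‖ₑ) + ∫⁻ x, ‖χ x‖ₑ := 
            lintegral_add_left ((hc.comp (continuous_add_const v)).enorm.measurable) _
        _ = 2 * ∫⁻ x, ‖χ x‖ₑ := by rw [lintegral_add_right_eq_self (fun x => ‖χ x‖ₑ), two_mul]
        _ ≤ _ := by gcongr
    calc _ ≤ 2 * (2 * ENNReal.ofReal (M ^ 2)) := by gcongr
      _ = _ := by
        rw [ENNReal.ofReal_mul (by positivity), ← mul_assoc, ENNReal.ofReal_ofNat]
        norm_num


lemma K_lower (a : ℝ) :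
    ENNReal.ofReal (|a| ^ (1/2 : ℝ)) ≤
      ∫⁻ t in Ioi (0:ℝ), ENNReal.ofReal (t ^ (-(3/2) : ℝ)) * ‖(Real.fourierChar (t * a) : ℂ) - 1‖ₑ ^ 2 := by
  rcases eq_or_ne a 0 with rfl | ha
  · simp
  have hb : 0 < |a| := abs_pos.2 ha
  set b := |a| with hbdef
  have hpt : ∀ t ∈ Icc (1/(4*b)) (1/(2*b)), ENNReal.ofReal (2 * (2*b) ^ (3/2:ℝ)) ≤
      ENNReal.ofReal (t ^ (-(3/2) : ℝ)) * ‖(Real.fourierChar (t * a) : ℂ) - 1‖ₑ ^ 2 := by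
    rintro t ⟨ht1, ht2⟩
    have ht0 : 0 < t := lt_of_lt_of_le (by positivity) ht1
    rw [← ofReal_norm, ← ENNReal.ofReal_pow (by positivity), ← ENNReal.ofReal_mul (by positivity)]
    apply ENNReal.ofReal_le_ofReal
    have e1 : (2*b) ^ (3/2:ℝ) ≤ t ^ (-(3/2) : ℝ) := by
      rw [Real.rpow_neg ht0.le, ← Real.inv_rpow ht0.le]
      apply Real.rpow_le_rpow (by positivity) _ (by norm_num)
      rw [le_inv_comm₀ (by positivity) ht0]
      simpa using ht2
    have e2 : 2 ≤ ‖(Real.fourierChar (t * a) : ℂ) - 1‖ ^ 2 := by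
      rw [Real.fourierChar_apply]
      have h4 : (Complex.exp (↑(2 * Real.pi * (t * a)) * Complex.I)).re ≤ 0 := by
        rw [Complex.exp_ofReal_mul_I_re, ← Real.cos_abs]
        have h5 : |2 * Real.pi * (t * a)| = 2 * Real.pi * (t * b) := by
          rw [abs_mul, abs_mul t, abs_of_pos ht0, abs_of_pos Real.two_pi_pos]
        rw [h5]
        have h6 : 1/4 ≤ t * b := by
          have := mul_le_mul_of_nonneg_right ht1 hb.le
          field_simp at this; linarith
        have h7 : t * b ≤ 1/2 := by
          have := mul_le_mul_of_nonneg_right ht2 hb.le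
          field_simp at this; linarith
        apply Real.cos_nonpos_of_pi_div_two_le_of_le
        · nlinarith [Real.pi_pos]
        · nlinarith [Real.pi_pos]
      have h8 : ‖Complex.exp (↑(2 * Real.pi * (t * a)) * Complex.I)‖ = 1 :=
        Complex.norm_exp_ofReal_mul_I _
      generalize Complex.exp (↑(2 * Real.pi * (t * a)) * Complex.I) = z at h4 h8
      have h9 : z.re * z.re + z.im * z.im = 1 := by
        have := Complex.normSq_apply z
        rw [Complex.normSq_eq_norm_sq, h8] at this
        linarith
      rw [← Complex.normSq_eq_norm_sq, Complex.normSq_apply]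
      simp
      nlinarith
    rw [mul_comm]
    gcongr
  calc ENNReal.ofReal (b ^ (1/2 : ℝ))
      ≤ ∫⁻ t in Icc (1/(4*b)) (1/(2*b)), ENNReal.ofReal (2 * (2*b) ^ (3/2:ℝ)) := by
        rw [setLIntegral_const, Real.volume_Icc, ← ENNReal.ofReal_mul (by positivity)]
        apply ENNReal.ofReal_le_ofReal
        have : 2 * (2*b) ^ (3/2:ℝ) * (1 / (2 * b) - 1 / (4 * b)) = (2:ℝ)^(1/2:ℝ) * b^(1/2:ℝ) := by
          rw [show (3/2:ℝ) = 1 + 1/2 by norm_num, Real.rpow_add (by positivity), Real.rpow_one,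
            Real.mul_rpow (by positivity) hb.le]
          field_simp
          norm_num
        rw [this]
        have : 1 ≤ (2:ℝ)^(1/2:ℝ) := Real.one_le_rpow (by norm_num) (by norm_num)
        nlinarith [Real.rpow_nonneg hb.le (1/2)]
    _ ≤ ∫⁻ t in Icc (1/(4*b)) (1/(2*b)), ENNReal.ofReal (t ^ (-(3/2) : ℝ)) * ‖(Real.fourierChar (t * a) : ℂ) - 1‖ₑ ^ 2 :=
        setLIntegral_mono' measurableSet_Icc hpt
    _ ≤ _ := lintegral_mono_set fun t ht => lt_of_lt_of_le (show 0 < 1/(4*b) by positivity) ht.1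

lemma upper_int (M : ℝ) (hM : 0 < M) :
    ∫⁻ t in Ioi (0:ℝ), ENNReal.ofReal (t ^ (-(3/2) : ℝ)) * ENNReal.ofReal (min (2 * t * M) (4 * M ^ 2))
      ≤ ENNReal.ofReal (12 * M ^ (3/2:ℝ)) := by
  have e : Ioi (0:ℝ) = Ioc 0 M ∪ Ioi M := by rw [Ioc_union_Ioi_eq_Ioi hM.le]
  rw [e]
  refine (lintegral_union_le _ _ _).trans ?_
  have hM32 : M ^ (3/2:ℝ) = M * M ^ (1/2:ℝ) := by
    rw [show (3/2:ℝ) = 1 + 1/2 by norm_num, Real.rpow_add hM, Real.rpow_one]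
  have a1 : ∫⁻ t in Ioc (0:ℝ) M, ENNReal.ofReal (t ^ (-(3/2) : ℝ)) * ENNReal.ofReal (min (2 * t * M) (4 * M ^ 2))
      ≤ ENNReal.ofReal (4 * M ^ (3/2:ℝ)) := by
    have hi : IntervalIntegrable (fun t : ℝ => t ^ (-(1/2):ℝ)) volume 0 M :=
      intervalIntegral.intervalIntegrable_rpow' (by norm_num)
    have hv : ∫ t in (0:ℝ)..M, t ^ (-(1/2):ℝ) = 2 * M ^ (1/2:ℝ) := by
      rw [integral_rpow (by left; norm_num)]
      norm_num
      ring
    calc _ ≤ ∫⁻ t in Ioc (0:ℝ) M, ENNReal.ofReal (2 * M * t ^ (-(1/2):ℝ)) := by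
          refine setLIntegral_mono' measurableSet_Ioc fun t ht => ?_
          rw [← ENNReal.ofReal_mul (Real.rpow_nonneg ht.1.le _)]
          apply ENNReal.ofReal_le_ofReal
          have : t ^ (-(1/2):ℝ) = t * t ^ (-(3/2):ℝ) := by
            rw [show (-(1/2):ℝ) = 1 + -(3/2) by norm_num, Real.rpow_add ht.1, Real.rpow_one]
          rw [this]
          have := mul_le_mul_of_nonneg_left (min_le_left (2 * t * M) (4 * M ^ 2)) (Real.rpow_nonneg ht.1.le (-(3/2)))
          linarith
      _ = ENNReal.ofReal (∫ t in Ioc (0:ℝ) M, 2 * M * t ^ (-(1/2):ℝ)) := by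
          rw [ofReal_integral_eq_lintegral_ofReal]
          · exact hi.1.const_mul _
          · filter_upwards [ae_restrict_mem measurableSet_Ioc] with t ht
            have := Real.rpow_nonneg ht.1.le (-(1/2))
            positivity
      _ = _ := by
          rw [← intervalIntegral.integral_of_le hM.le, intervalIntegral.integral_const_mul, hv, hM32]
          congr 1; ring
  have a2 : ∫⁻ t in Ioi M, ENNReal.ofReal (t ^ (-(3/2) : ℝ)) * ENNReal.ofReal (min (2 * t * M) (4 * M ^ 2))
      ≤ ENNReal.ofReal (8 * M ^ (3/2:ℝ)) := by
    have hi := integrableOn_Ioi_rpow_of_lt (a := (-(3/2):ℝ)) (by norm_num) hM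
    have hv := integral_Ioi_rpow_of_lt (a := (-(3/2):ℝ)) (by norm_num) hM
    calc _ ≤ ∫⁻ t in Ioi M, ENNReal.ofReal (4 * M ^ 2 * t ^ (-(3/2):ℝ)) := by
          refine setLIntegral_mono' measurableSet_Ioi fun t ht => ?_
          have ht0 : 0 < t := hM.trans ht
          rw [← ENNReal.ofReal_mul (Real.rpow_nonneg ht0.le _)]
          apply ENNReal.ofReal_le_ofReal
          have := mul_le_mul_of_nonneg_left (min_le_right (2 * t * M) (4 * M ^ 2)) (Real.rpow_nonneg ht0.le (-(3/2)))
          linarith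
      _ = ENNReal.ofReal (∫ t in Ioi M, 4 * M ^ 2 * t ^ (-(3/2):ℝ)) := by
          rw [ofReal_integral_eq_lintegral_ofReal]
          · exact hi.const_mul _
          · filter_upwards [ae_restrict_mem measurableSet_Ioi] with t ht
            have := Real.rpow_nonneg (hM.trans ht).le (-(3/2))
            positivity
      _ = _ := by
          rw [integral_const_mul, hv, hM32]
          have : M ^ (1/2:ℝ) = M * M ^ (-(1/2):ℝ) := by
            rw [show (1/2:ℝ) = 1 + -(1/2) by norm_num, Real.rpow_add hM, Real.rpow_one]; norm_num
          rw [this]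
          congr 1; norm_num; ring
  refine (add_le_add a1 a2).trans ?_
  rw [← ENNReal.ofReal_add (by positivity) (by positivity)]
  apply ENNReal.ofReal_le_ofReal
  linarith


lemma weighted_L2 (χ : E2 → ℝ) (hχ : ContDiff ℝ ∞ χ) (hs : HasCompactSupport χ)
    (h1 : ∀ x, |χ x| ≤ 1) (M : ℝ) (hM : 0 < M)
    (hP : ∫⁻ x, ‖fderiv ℝ χ x‖ₑ ≤ ENNReal.ofReal M)
    (hV : ∫⁻ x, ‖χ x‖ₑ ≤ ENNReal.ofReal (M ^ 2)) :
    ∫⁻ ξ, ENNReal.ofReal (‖ξ‖ ^ (1/2:ℝ)) * ‖𝓕 (fun x => (χ x : ℂ)) ξ‖ₑ ^ 2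
      ≤ ENNReal.ofReal (24 * M ^ (3/2:ℝ)) := by
  have hs0 : HasCompactSupport (fun x => (χ x : ℂ)) := hs.comp_left (g := fun t : ℝ => (t : ℂ)) (by simp)
  have hd0 : ContDiff ℝ ∞ (fun x => (χ x : ℂ)) := Complex.ofRealCLM.contDiff.comp hχ
  have hFc : Continuous (𝓕 (fun x => (χ x : ℂ))) := by
    have := (𝓕 (hs0.toSchwartzMap hd0)).continuous
    rwa [SchwartzMap.fourier_coe] at this
  set F := 𝓕 (fun x => (χ x : ℂ)) with hF
  have hi : ∀ i : Fin 2, ∫⁻ ξ : E2, ENNReal.ofReal (|ξ i| ^ (1/2:ℝ)) * ‖F ξ‖ₑ ^ 2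
      ≤ ENNReal.ofReal (12 * M ^ (3/2:ℝ)) := by
    intro i
    calc ∫⁻ ξ : E2, ENNReal.ofReal (|ξ i| ^ (1/2:ℝ)) * ‖F ξ‖ₑ ^ 2
        ≤ ∫⁻ ξ : E2, ∫⁻ t in Ioi (0:ℝ), ENNReal.ofReal (t ^ (-(3/2) : ℝ)) *
            (‖(Real.fourierChar (t * ξ i) : ℂ) - 1‖ₑ ^ 2 * ‖F ξ‖ₑ ^ 2) := by
          refine lintegral_mono fun ξ => ?_
          simp only [← mul_assoc]
          rw [lintegral_mul_const' _ _ (by simp)]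
          gcongr
          exact K_lower _
      _ = ∫⁻ t in Ioi (0:ℝ), ∫⁻ ξ : E2, ENNReal.ofReal (t ^ (-(3/2) : ℝ)) *
            (‖(Real.fourierChar (t * ξ i) : ℂ) - 1‖ₑ ^ 2 * ‖F ξ‖ₑ ^ 2) := by
          rw [lintegral_lintegral_swap]
          apply Measurable.aemeasurable
          unfold Function.uncurry
          have m1 : Measurable (fun p : E2 × ℝ => ENNReal.ofReal (p.2 ^ (-(3/2) : ℝ))) := by fun_prop
          have m2 : Measurable (fun p : E2 × ℝ => ‖(Real.fourierChar (p.2 * p.1 i) : ℂ) - 1‖ₑ ^ 2) := by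
            refine Measurable.pow_const ?_ _
            refine Continuous.measurable ?_
            refine Continuous.enorm ?_
            refine Continuous.sub ?_ continuous_const
            refine continuous_subtype_val.comp (Real.continuous_fourierChar.comp ?_)
            fun_prop
          have m3 : Measurable (fun p : E2 × ℝ => ‖F p.1‖ₑ ^ 2) :=
            ((hFc.comp continuous_fst).enorm.measurable).pow_const _
          exact m1.mul (m2.mul m3)
      _ = ∫⁻ t in Ioi (0:ℝ), ENNReal.ofReal (t ^ (-(3/2) : ℝ)) *
            ∫⁻ x, ‖χ (x + t • EuclideanSpace.single i 1) - χ x‖ₑ ^ 2 := by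
          refine lintegral_congr fun t => ?_
          rw [lintegral_const_mul' _ _ (by simp), ← plancherel_diff χ hχ hs]
          congr 2
          ext ξ
          simp [inner_smul_left, EuclideanSpace.inner_single_left, hF]
      _ ≤ ∫⁻ t in Ioi (0:ℝ), ENNReal.ofReal (t ^ (-(3/2) : ℝ)) *
            ENNReal.ofReal (min (2 * t * M) (4 * M ^ 2)) := by
          refine setLIntegral_mono' measurableSet_Ioi fun t ht => ?_
          gcongr
          refine (diff_bounds χ hχ h1 M hM hP hV _).trans (le_of_eq ?_)
          have : ‖t • (EuclideanSpace.single i (1:ℝ) : E2)‖ = t := by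
            rw [norm_smul]; simp [abs_of_pos (show 0 < t from ht)]
          rw [this]
      _ ≤ _ := upper_int M hM
  have hn : ∀ ξ : E2, ‖ξ‖ ^ (1/2:ℝ) ≤ |ξ 0| ^ (1/2:ℝ) + |ξ 1| ^ (1/2:ℝ) := by
    intro ξ
    have : ‖ξ‖ ≤ |ξ 0| + |ξ 1| := by
      rw [EuclideanSpace.norm_eq, Fin.sum_univ_two]
      apply Real.sqrt_le_left (by positivity) |>.2
      simp only [Real.norm_eq_abs]
      nlinarith [abs_nonneg (ξ 0), abs_nonneg (ξ 1)]
    refine (Real.rpow_le_rpow (norm_nonneg _) this (by norm_num)).trans ?_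
    exact Real.rpow_add_le_add_rpow (abs_nonneg _) (abs_nonneg _) (by norm_num) (by norm_num)
  calc _ ≤ ∫⁻ ξ : E2, (ENNReal.ofReal (|ξ 0| ^ (1/2:ℝ)) * ‖F ξ‖ₑ ^ 2 + ENNReal.ofReal (|ξ 1| ^ (1/2:ℝ)) * ‖F ξ‖ₑ ^ 2) := by
        refine lintegral_mono fun ξ => ?_
        rw [← add_mul, ← ENNReal.ofReal_add (by positivity) (by positivity)]
        gcongr
        exact hn ξ
    _ = (∫⁻ ξ : E2, ENNReal.ofReal (|ξ 0| ^ (1/2:ℝ)) * ‖F ξ‖ₑ ^ 2) + ∫⁻ ξ : E2, ENNReal.ofReal (|ξ 1| ^ (1/2:ℝ)) * ‖F ξ‖ₑ ^ 2 := by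
        apply lintegral_add_left
        refine Measurable.mul ?_ (hFc.enorm.measurable.pow_const _)
        fun_prop
    _ ≤ _ := add_le_add (hi 0) (hi 1)
    _ = _ := by
        rw [← ENNReal.ofReal_add (by positivity) (by positivity)]
        congr 1; ring

/-- radial weight -/
def radW (r : ℝ) : ℝ := if r < 1 then r⁻¹ else r ^ (-(5/2) : ℝ)

lemma radW_nonneg (r : ℝ) (hr : 0 ≤ r) : 0 ≤ radW r := by
  unfold radW; split_ifs <;> positivity

lemma radW_integrable : Integrable (fun ξ : E2 => radW ‖ξ‖) := by
  rw [integrable_fun_norm_addHaar]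
  have e : Ioi (0:ℝ) = Ioo 0 1 ∪ Ici 1 := by rw [Ioo_union_Ici_eq_Ioi zero_lt_one]
  rw [e, integrableOn_union]
  simp only [finrank_euclideanSpace, Fintype.card_fin, Nat.reduceSub, pow_one, smul_eq_mul]
  constructor
  · have : IntegrableOn (fun _ : ℝ => (1:ℝ)) (Ioo 0 1) := by simp
    refine this.congr_fun (fun y hy => ?_) measurableSet_Ioo
    simp [radW, hy.2, hy.1.ne']
  · rw [integrableOn_Ici_iff_integrableOn_Ioi]
    refine (integrableOn_Ioi_rpow_of_lt (a := (-(3/2):ℝ)) (by norm_num) zero_lt_one).congr_fun (fun y hy => ?_) measurableSet_Ioi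
    have hy' : 1 < y := hy
    have hy0 : 0 < y := by linarith
    simp only [radW, not_lt.2 hy'.le, if_false]
    rw [show (-(3/2):ℝ) = 1 + -(5/2) by norm_num, Real.rpow_add hy0, Real.rpow_one]

lemma radW_scaled (M : ℝ) (hM : 0 < M) :
    ∫⁻ ξ : E2, ENNReal.ofReal (M ^ 3 * radW ‖M • ξ‖)
      = ENNReal.ofReal (M * ∫ ξ : E2, radW ‖ξ‖) := by
  have hi : Integrable (fun ξ : E2 => radW ‖M • ξ‖) :=
    (integrable_comp_smul_iff volume (fun ξ : E2 => radW ‖ξ‖) hM.ne').2 radW_integrable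
  rw [← ofReal_integral_eq_lintegral_ofReal (hi.const_mul _)]
  · rw [integral_const_mul, Measure.integral_comp_smul volume (fun ξ : E2 => radW ‖ξ‖)]
    congr 1
    simp only [finrank_euclideanSpace, Fintype.card_fin, smul_eq_mul]
    rw [abs_of_pos (by positivity)]
    field_simp
  · filter_upwards with ξ
    have := radW_nonneg ‖M • ξ‖ (norm_nonneg _)
    positivity

/-- key lemma for functions that behave like characteristic functions -/
lemma key : ∃ C : ℝ≥0, ∀ (χ : E2 → ℝ), ContDiff ℝ ∞ χ → HasCompactSupport χ →
    (∀ x, |χ x| ≤ 1) → ∀ (M : ℝ), 0 < M →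
    (∫⁻ x, ‖fderiv ℝ χ x‖ₑ ≤ ENNReal.ofReal M) →
    (∫⁻ x, ‖χ x‖ₑ ≤ ENNReal.ofReal (M ^ 2)) →
    ∫⁻ ξ, ‖𝓕 (fun x => (χ x : ℂ)) ξ‖ₑ * ENNReal.ofReal (‖ξ‖⁻¹) ≤ C * ENNReal.ofReal M := by
  refine ⟨((∫ ξ : E2, radW ‖ξ‖) + 24).toNNReal, ?_⟩
  intro χ hχ hs h1 M hM hP hV
  have hK : 0 ≤ ∫ ξ : E2, radW ‖ξ‖ := integral_nonneg fun ξ => radW_nonneg _ (norm_nonneg _)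
  have hw := weighted_L2 χ hχ hs h1 M hM hP hV
  have hsup : ∀ ξ, ‖𝓕 (fun x => (χ x : ℂ)) ξ‖ ≤ M ^ 2 := by
    intro ξ
    have : ‖𝓕 (fun x => (χ x : ℂ)) ξ‖ₑ ≤ ENNReal.ofReal (M ^ 2) := by
      refine le_trans ?_ hV
      rw [Real.fourier_eq]
      refine (enorm_integral_le_lintegral_enorm _).trans (le_of_eq (lintegral_congr fun x => ?_))
      simp [← ofReal_norm]
    rw [← ofReal_norm] at this
    exact (ENNReal.ofReal_le_ofReal_iff (by positivity)).1 this
  have hpt : ∀ ξ : E2, ‖𝓕 (fun x => (χ x : ℂ)) ξ‖ₑ * ENNReal.ofReal (‖ξ‖⁻¹) ≤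
      ENNReal.ofReal (M ^ 3 * radW ‖M • ξ‖) +
        ENNReal.ofReal (M ^ (-(1/2):ℝ)) * (ENNReal.ofReal (‖ξ‖ ^ (1/2:ℝ)) * ‖𝓕 (fun x => (χ x : ℂ)) ξ‖ₑ ^ 2) := by
    intro ξ
    have ha := hsup ξ
    rw [← ofReal_norm]
    have ha0 := norm_nonneg (𝓕 (fun x => (χ x : ℂ)) ξ)
    generalize ‖𝓕 (fun x => (χ x : ℂ)) ξ‖ = a at ha ha0
    rcases eq_or_ne ξ 0 with rfl | hξ
    · simp
    have hr : 0 < ‖ξ‖ := norm_pos_iff.2 hξ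
    rw [norm_smul, Real.norm_eq_abs, abs_of_pos hM]
    generalize ‖ξ‖ = r at hr
    have hrw := radW_nonneg (M * r) (by positivity)
    rw [← ENNReal.ofReal_pow ha0, ← ENNReal.ofReal_mul (by positivity), ← ENNReal.ofReal_mul (by positivity), ← ENNReal.ofReal_mul (by positivity),
      ← ENNReal.ofReal_add (by positivity) (by positivity)]
    apply ENNReal.ofReal_le_ofReal
    unfold radW
    split_ifs with hlt
    · have : a * r⁻¹ ≤ M ^ 3 * (M * r)⁻¹ := by
        have : M ^ 3 * (M * r)⁻¹ = M ^ 2 * r⁻¹ := by field_simp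
        rw [this]; gcongr
      have : 0 ≤ M ^ (-(1/2):ℝ) * (r ^ (1/2:ℝ) * a ^ 2) := by positivity
      linarith
    · obtain ⟨m, hm, rfl⟩ : ∃ m, 0 < m ∧ M = m ^ 4 := ⟨M ^ (1/4:ℝ), by positivity, by
        rw [← Real.rpow_natCast, ← Real.rpow_mul hM.le]; norm_num⟩
      obtain ⟨q, hq, rfl⟩ : ∃ q, 0 < q ∧ r = q ^ 4 := ⟨r ^ (1/4:ℝ), by positivity, by
        rw [← Real.rpow_natCast, ← Real.rpow_mul hr.le]; norm_num⟩
      have e1 : (m ^ 4 * q ^ 4) ^ (-(5/2):ℝ) = ((m*q) ^ 10)⁻¹ := by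
        rw [← mul_pow, ← Real.rpow_natCast, ← Real.rpow_mul (by positivity), ← Real.rpow_natCast, ← Real.rpow_neg (by positivity)]
        norm_num
      have e2 : (m ^ 4) ^ (-(1/2):ℝ) = (m ^ 2)⁻¹ := by
        rw [← Real.rpow_natCast, ← Real.rpow_mul (by positivity), ← Real.rpow_natCast, ← Real.rpow_neg (by positivity)]
        norm_num
      have e3 : (q ^ 4) ^ ((1/2):ℝ) = q ^ 2 := by
        rw [← Real.rpow_natCast, ← Real.rpow_mul (by positivity), ← Real.rpow_natCast]
        norm_num
      rw [e1, e2, e3]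
      have : 0 ≤ ((m / q ^ 5) - (q * a / m)) ^ 2 := sq_nonneg _
      have h5 : a * (q ^ 4)⁻¹ = (m / q ^ 5) * (q * a / m) := by field_simp
      have h6 : (m ^ 4) ^ 3 * ((m * q) ^ 10)⁻¹ = (m / q ^ 5) ^ 2 := by field_simp
      have h7 : (m ^ 2)⁻¹ * (q ^ 2 * a ^ 2) = (q * a / m) ^ 2 := by field_simp
      rw [h5, h6, h7]
      nlinarith [sq_nonneg (m / q ^ 5), sq_nonneg (q * a / m)]
  calc _ ≤ ∫⁻ ξ : E2, (ENNReal.ofReal (M ^ 3 * radW ‖M • ξ‖) +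
        ENNReal.ofReal (M ^ (-(1/2):ℝ)) * (ENNReal.ofReal (‖ξ‖ ^ (1/2:ℝ)) * ‖𝓕 (fun x => (χ x : ℂ)) ξ‖ₑ ^ 2)) := lintegral_mono hpt
    _ = (∫⁻ ξ : E2, ENNReal.ofReal (M ^ 3 * radW ‖M • ξ‖)) + ENNReal.ofReal (M ^ (-(1/2):ℝ)) *
        ∫⁻ ξ : E2, (ENNReal.ofReal (‖ξ‖ ^ (1/2:ℝ)) * ‖𝓕 (fun x => (χ x : ℂ)) ξ‖ₑ ^ 2) := by
        rw [lintegral_add_left, lintegral_const_mul' _ _ (by simp)]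
        have : Measurable radW := by
          unfold radW
          exact Measurable.ite measurableSet_Iio (by fun_prop) (by fun_prop)
        fun_prop
    _ ≤ ENNReal.ofReal (M * ∫ ξ : E2, radW ‖ξ‖) + ENNReal.ofReal (M ^ (-(1/2):ℝ)) * ENNReal.ofReal (24 * M ^ (3/2:ℝ)) := by
        rw [radW_scaled M hM]
        gcongr
    _ = _ := by
        rw [← ENNReal.ofReal_mul (by positivity), ← ENNReal.ofReal_add (by positivity) (by positivity)]
        have e : M ^ (-(1/2):ℝ) * (24 * M ^ (3/2:ℝ)) = 24 * M := by
          have : M ^ (-(1/2):ℝ) * M ^ (3/2:ℝ) = M := by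
            rw [← Real.rpow_add hM]; norm_num
          linarith
        change _ = ENNReal.ofReal ((∫ ξ : E2, radW ‖ξ‖) + 24) * ENNReal.ofReal M
        rw [e, ← ENNReal.ofReal_mul (by positivity)]
        congr 1; ring


lemma key' : ∃ C : ℝ≥0, ∀ (χ w : E2 → ℝ), ContDiff ℝ ∞ χ → HasCompactSupport χ →
    ContDiff ℝ ∞ w → HasCompactSupport w →
    (∀ x, |χ x| ≤ 1) → (∀ x, |χ x| ≤ w x ^ 2) →
    ∫⁻ ξ, ‖𝓕 (fun x => (χ x : ℂ)) ξ‖ₑ * ENNReal.ofReal (‖ξ‖⁻¹) ≤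
      C * ((∫⁻ x, ‖fderiv ℝ χ x‖ₑ) + ∫⁻ x, ‖fderiv ℝ w x‖ₑ) := by
  obtain ⟨C, hC⟩ := key
  set C0 := lintegralPowLePowLIntegralFDerivConst (volume : Measure E2) 2 with hC0
  refine ⟨(C + 1) * (C0 + 1), ?_⟩
  intro χ w hχ hχs hw hws h1 h2
  set P := ∫⁻ x, ‖fderiv ℝ χ x‖ₑ with hP
  set Q := ∫⁻ x, ‖fderiv ℝ w x‖ₑ with hQ
  have hGN : ∫⁻ x, ‖χ x‖ₑ ≤ C0 * Q ^ 2 := by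
    have hconj : Real.HolderConjugate (Module.finrank ℝ E2) 2 := by
      simp only [finrank_euclideanSpace, Fintype.card_fin]
      norm_num
      exact Real.HolderConjugate.two_two
    have := lintegral_pow_le_pow_lintegral_fderiv (μ := (volume : Measure E2))
      (hw.of_le (by simp)) hws hconj
    refine le_trans (lintegral_mono fun x => ?_) (this.trans (le_of_eq ?_))
    · have e : ‖w x‖ₑ ^ (2:ℝ) = ENNReal.ofReal (w x ^ 2) := by
        rw [← ofReal_norm, ENNReal.rpow_two, ← ENNReal.ofReal_pow (norm_nonneg _)]
        simp
      change ‖χ x‖ₑ ≤ ‖w x‖ₑ ^ (2:ℝ)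
      rw [e, ← ofReal_norm]
      exact ENNReal.ofReal_le_ofReal (h2 x)
    · rw [ENNReal.rpow_two]
  rcases eq_or_ne (P + (C0 + 1) * Q) ⊤ with htop | htop
  · have : P + Q = ⊤ := by
      by_contra h
      rw [ENNReal.add_eq_top, not_or] at h
      exact (ENNReal.add_ne_top.2 ⟨h.1, ENNReal.mul_ne_top (by simp) h.2⟩) htop
    rw [this, ENNReal.mul_top (by
      simp only [ne_eq, ENNReal.coe_eq_zero]; positivity)]
    exact le_top
  set A := P + (C0 + 1) * Q with hA
  have main : ∫⁻ ξ, ‖𝓕 (fun x => (χ x : ℂ)) ξ‖ₑ * ENNReal.ofReal (‖ξ‖⁻¹) ≤ (C + 1) * A := by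
    apply ENNReal.le_of_forall_pos_le_add
    intro ε hε _
    set δ : ℝ≥0 := ε / (C + 1) with hδ
    have hδ0 : 0 < δ := by positivity
    have hM : ENNReal.ofReal (A.toReal + δ) = A + δ := by
      rw [ENNReal.ofReal_add (by positivity) (by positivity), ENNReal.ofReal_toReal htop]
      simp
    have := hC χ hχ hχs h1 (A.toReal + δ) (by positivity) ?_ ?_
    · refine this.trans ?_
      rw [hM]
      calc (C:ℝ≥0∞) * (A + δ) ≤ (C + 1) * (A + δ) := by gcongr; exact le_self_add
        _ = (C + 1) * A + (C+1) * δ := by rw [mul_add]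
        _ = _ := by
          congr 1
          rw [hδ]
          norm_cast
          field_simp
    · rw [hM]
      exact le_self_add.trans le_self_add
    · rw [ENNReal.ofReal_pow (by positivity), hM]
      refine hGN.trans ?_
      calc (C0 : ℝ≥0∞) * Q ^ 2 ≤ (C0 + 1) ^ 2 * Q ^ 2 := by
            gcongr
            norm_cast
            nlinarith [(zero_le : 0 ≤ C0)]
        _ = ((C0 + 1) * Q) ^ 2 := by rw [mul_pow]
        _ ≤ _ := by
          gcongr
          exact le_add_self.trans le_self_add
  refine main.trans ?_
  push_cast
  rw [mul_assoc]
  gcongr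
  rw [hA, mul_add]
  gcongr
  exact le_mul_of_one_le_left (by simp) (by simp)

/-- smooth truncation -/
def gS (s t : ℝ) : ℝ := t ^ 5 * s / (s ^ 2 + t ^ 2) ^ 3
/-- auxiliary truncation -/
def gW (s t : ℝ) : ℝ := t ^ 2 / (s ^ 2 + t ^ 2)

lemma gS_contDiff (s : ℝ) (hs : 0 < s) : ContDiff ℝ ∞ (gS s) := by
  unfold gS
  exact ContDiff.div (by fun_prop) (by fun_prop) (fun t => by positivity)

lemma gW_contDiff (s : ℝ) (hs : 0 < s) : ContDiff ℝ ∞ (gW s) := by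
  unfold gW
  exact ContDiff.div (by fun_prop) (by fun_prop) (fun t => by positivity)

lemma gS_abs (s t : ℝ) (hs : 0 < s) : |gS s t| = gS s |t| := by
  unfold gS
  rw [abs_div, abs_mul, abs_of_pos hs, abs_pow, sq_abs, abs_of_pos (show 0 < (s^2+t^2)^3 by positivity)]

lemma gS_le_sq (s t : ℝ) (hs : 0 < s) : |gS s t| ≤ gW s t ^ 2 := by
  rw [gS_abs s t hs]
  unfold gS gW
  rw [sq_abs, div_pow, div_le_div_iff₀ (by positivity) (by positivity)]
  have h : |t| * s ≤ s ^ 2 + t ^ 2 := by nlinarith [sq_abs t, sq_nonneg (|t| - s)]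
  have e : |t| ^ 5 = t ^ 4 * |t| := by
    rw [pow_succ, show |t|^4 = t^4 by rw [← abs_pow]; exact abs_of_nonneg (by positivity)]
  rw [e]
  calc t ^ 4 * |t| * s * (s ^ 2 + t ^ 2) ^ 2 = (t ^ 4 * (s ^ 2 + t ^ 2) ^ 2) * (|t| * s) := by ring
    _ ≤ (t ^ 4 * (s ^ 2 + t ^ 2) ^ 2) * (s ^ 2 + t ^ 2) := by gcongr
    _ = _ := by ring

lemma gW_le_one (s t : ℝ) (hs : 0 < s) : gW s t ^ 2 ≤ 1 := by
  unfold gW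
  have : t ^ 2 / (s ^ 2 + t ^ 2) ≤ 1 := by
    rw [div_le_one (by positivity)]; nlinarith
  exact pow_le_one₀ (by positivity) this

lemma gS_deriv (s t : ℝ) (hs : 0 < s) : |deriv (gS s) t| ≤ 6 * s * t ^ 4 / (s ^ 2 + t ^ 2) ^ 3 := by
  have hd : HasDerivAt (gS s) ((5 * t ^ 4 * s * (s ^ 2 + t ^ 2) ^ 3 - t ^ 5 * s * (3 * (s ^ 2 + t ^ 2) ^ 2 * (2 * t)))
      / ((s ^ 2 + t ^ 2) ^ 3) ^ 2) t := by
    unfold gS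
    have h1 : HasDerivAt (fun t : ℝ => t ^ 5 * s) (5 * t ^ 4 * s) t := by
      simpa using (hasDerivAt_pow 5 t).mul_const s
    have h2 : HasDerivAt (fun t : ℝ => (s ^ 2 + t ^ 2) ^ 3) (3 * (s ^ 2 + t ^ 2) ^ 2 * (2 * t)) t := by
      exact (((hasDerivAt_pow 2 t).const_add (s ^ 2)).pow 3).congr_deriv (by norm_num)
    exact h1.div h2 (by positivity)
  rw [hd.deriv]
  have e : (5 * t ^ 4 * s * (s ^ 2 + t ^ 2) ^ 3 - t ^ 5 * s * (3 * (s ^ 2 + t ^ 2) ^ 2 * (2 * t)))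
      / ((s ^ 2 + t ^ 2) ^ 3) ^ 2 = (s * t ^ 4 / (s ^ 2 + t ^ 2) ^ 3) * ((5 * s ^ 2 - t ^ 2) / (s ^ 2 + t ^ 2)) := by
    field_simp; ring
  rw [e, abs_mul, abs_of_nonneg (by positivity)]
  have : |(5 * s ^ 2 - t ^ 2) / (s ^ 2 + t ^ 2)| ≤ 6 := by
    rw [abs_div, abs_of_pos (show 0 < s^2+t^2 by positivity), div_le_iff₀ (by positivity), abs_le]
    constructor <;> nlinarith [sq_nonneg t, sq_nonneg s]
  calc _ ≤ (s * t ^ 4 / (s ^ 2 + t ^ 2) ^ 3) * 6 := by gcongr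
    _ = _ := by ring

lemma gW_deriv (s t : ℝ) (hs : 0 < s) : |deriv (gW s) t| ≤ 2 * (|t| / (s ^ 2 + t ^ 2)) := by
  have hd : HasDerivAt (gW s) ((2 * t * (s ^ 2 + t ^ 2) - t ^ 2 * (2 * t))
      / (s ^ 2 + t ^ 2) ^ 2) t := by
    unfold gW
    have h1 : HasDerivAt (fun t : ℝ => t ^ 2) (2 * t) t := by
      simpa using (hasDerivAt_pow 2 t)
    exact h1.div (h1.const_add (s ^ 2)) (by positivity)
  rw [hd.deriv]
  have e : (2 * t * (s ^ 2 + t ^ 2) - t ^ 2 * (2 * t)) / (s ^ 2 + t ^ 2) ^ 2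
     = 2 * (t / (s ^ 2 + t ^ 2)) * (s ^ 2 / (s ^ 2 + t ^ 2)) := by
    field_simp; ring
  have h1 : |s ^ 2 / (s ^ 2 + t ^ 2)| ≤ 1 := by
    rw [abs_of_nonneg (by positivity), div_le_one (by positivity)]; nlinarith
  rw [e, abs_mul, abs_mul, abs_div, abs_of_pos (show 0 < s^2+t^2 by positivity), abs_two]
  exact mul_le_of_le_one_right (by positivity) h1

lemma base_int (t : ℝ) (ht : t ≠ 0) :
    IntegrableOn (fun s : ℝ => s / (s ^ 2 + t ^ 2) ^ 3) (Ioi 0) ∧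
    ∫ s in Ioi (0:ℝ), s / (s ^ 2 + t ^ 2) ^ 3 = 1 / (4 * t ^ 4) := by
  have hd : ∀ s ∈ Ici (0:ℝ), HasDerivAt (fun s : ℝ => -(1/4) * ((s ^ 2 + t ^ 2) ^ 2)⁻¹) (s / (s ^ 2 + t ^ 2) ^ 3) s := by
    intro s _
    have h2 : HasDerivAt (fun s : ℝ => (s ^ 2 + t ^ 2) ^ 2) (2 * (s ^ 2 + t ^ 2) * (2 * s)) s := by
      exact (((hasDerivAt_pow 2 s).add_const (t ^ 2)).pow 2).congr_deriv (by norm_num)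
    refine ((h2.inv (by positivity)).const_mul (-(1/4))).congr_deriv ?_
    field_simp
    ring
  have hp : ∀ s ∈ Ioi (0:ℝ), 0 ≤ s / (s ^ 2 + t ^ 2) ^ 3 := by
    intro s hs
    have : 0 < s := hs
    positivity
  have hl : Tendsto (fun s : ℝ => -(1/4) * ((s ^ 2 + t ^ 2) ^ 2)⁻¹) atTop (𝓝 0) := by
    have : Tendsto (fun s : ℝ => (s ^ 2 + t ^ 2) ^ 2) atTop atTop :=
      (tendsto_pow_atTop two_ne_zero).comp
        (tendsto_atTop_add_const_right _ _ (tendsto_pow_atTop two_ne_zero))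
    have h3 := this.inv_tendsto_atTop.const_mul (-(1/4))
    rw [mul_zero] at h3
    exact h3
  refine ⟨integrableOn_Ioi_deriv_of_nonneg' hd hp hl, ?_⟩
  rw [integral_Ioi_of_hasDerivAt_of_nonneg' hd hp hl]
  field_simp
  ring

lemma gS_int (t : ℝ) : IntegrableOn (fun s => gS s t) (Ioi 0) ∧ ∫ s in Ioi (0:ℝ), gS s t = t / 4 := by
  rcases eq_or_ne t 0 with rfl | ht
  · simp [gS]
  obtain ⟨h1, h2⟩ := base_int t ht
  have e : (fun s => gS s t) = fun s => t ^ 5 * (s / (s ^ 2 + t ^ 2) ^ 3) := by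
    ext s; unfold gS; ring
  rw [e]
  refine ⟨h1.const_mul _, ?_⟩
  rw [integral_const_mul, h2]
  field_simp

lemma dS_int (t : ℝ) : ∫⁻ s in Ioi (0:ℝ), ENNReal.ofReal (6 * s * t ^ 4 / (s ^ 2 + t ^ 2) ^ 3) ≤ 4 := by
  rcases eq_or_ne t 0 with rfl | ht
  · simp
  obtain ⟨h1, h2⟩ := base_int t ht
  have e : ∀ s : ℝ, 6 * s * t ^ 4 / (s ^ 2 + t ^ 2) ^ 3 = 6 * t ^ 4 * (s / (s ^ 2 + t ^ 2) ^ 3) := by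
    intro s; ring
  simp only [e]
  rw [← ofReal_integral_eq_lintegral_ofReal (h1.const_mul _), integral_const_mul, h2]
  · apply ENNReal.ofReal_le_of_le_toReal
    field_simp
    norm_num
  · filter_upwards [ae_restrict_mem measurableSet_Ioi] with s hs
    have : 0 < s := hs
    positivity

lemma dW_int (t : ℝ) : ∫⁻ s in Ioi (0:ℝ), ENNReal.ofReal (2 * (|t| / (s ^ 2 + t ^ 2))) ≤ 4 := by
  rcases eq_or_ne t 0 with rfl | ht
  · simp
  have ht' : 0 < |t| := abs_pos.2 ht
  have hd : ∀ s ∈ Ici (0:ℝ), HasDerivAt (fun s : ℝ => 2 * Real.arctan (s / |t|)) (2 * (|t| / (s ^ 2 + t ^ 2))) s := by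
    intro s _
    have h2 : HasDerivAt (fun s : ℝ => s / |t|) (1 / |t|) s := (hasDerivAt_id s).div_const _
    refine ((h2.arctan).const_mul 2).congr_deriv ?_
    rw [← sq_abs t]
    field_simp
    ring
  have hp : ∀ s ∈ Ioi (0:ℝ), 0 ≤ 2 * (|t| / (s ^ 2 + t ^ 2)) := by
    intro s hs
    positivity
  have hl : Tendsto (fun s : ℝ => 2 * Real.arctan (s / |t|)) atTop (𝓝 (2 * (Real.pi / 2))) := by
    refine Tendsto.const_mul _ ?_
    exact (tendsto_nhds_of_tendsto_nhdsWithin Real.tendsto_arctan_atTop).comp (tendsto_id.atTop_div_const ht')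
  rw [← ofReal_integral_eq_lintegral_ofReal (integrableOn_Ioi_deriv_of_nonneg' hd hp hl),
    integral_Ioi_of_hasDerivAt_of_nonneg' hd hp hl]
  · apply ENNReal.ofReal_le_of_le_toReal
    simp
    linarith [Real.pi_le_four]
  · filter_upwards [ae_restrict_mem measurableSet_Ioi] with s hs
    exact hp s hs


lemma enorm_clm_add (a b : E2 →L[ℝ] ℝ) : ‖a + b‖ₑ ≤ ‖a‖ₑ + ‖b‖ₑ := by
  rw [← ofReal_norm, ← ofReal_norm, ← ofReal_norm, ← ENNReal.ofReal_add (norm_nonneg _) (norm_nonneg _)]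
  exact ENNReal.ofReal_le_ofReal (norm_add_le _ _)

lemma fourier_cont (f : E2 → ℂ) (hf : Integrable f) : Continuous (𝓕 f) := by
  have := VectorFourier.fourierIntegral_continuous (μ := volume) (L := innerₗ E2) Real.continuous_fourierChar
    (by exact continuous_inner) hf
  exact this

lemma fderiv_comp_le (g : ℝ → ℝ) (hg : ContDiff ℝ ∞ g) (u : E2 → ℝ) (hu : ContDiff ℝ ∞ u) (x : E2) :
    ‖fderiv ℝ (fun x => g (u x)) x‖ₑ ≤ ENNReal.ofReal |deriv g (u x)| * ‖fderiv ℝ u x‖ₑ := by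
  have h1 : DifferentiableAt ℝ g (u x) := (hg.differentiable (by simp)) _
  have h2 : DifferentiableAt ℝ u x := (hu.differentiable (by simp)) _
  have h3 := (h1.hasDerivAt.comp_hasFDerivAt x h2.hasFDerivAt).fderiv
  have h4 : fderiv ℝ (fun x => g (u x)) x = deriv g (u x) • fderiv ℝ u x := h3
  rw [h4, enorm_smul, ← ofReal_norm (deriv g (u x)), Real.norm_eq_abs]

lemma fourier_slice (u : E2 → ℝ) (hu : Continuous u) (hi : Integrable u) (ξ : E2) :
    ‖𝓕 (fun x => (u x : ℂ)) ξ‖ₑ ≤ 4 * ∫⁻ s in Ioi (0:ℝ), ‖𝓕 (fun x => (gS s (u x) : ℂ)) ξ‖ₑ := by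
  have hm : Measurable (fun p : E2 × ℝ => gS p.2 (u p.1)) := by
    unfold gS
    have := hu.measurable
    fun_prop
  have hmc : Continuous (fun x : E2 => (Real.fourierChar (-⟪x, ξ⟫) : ℂ)) :=
    continuous_subtype_val.comp (Real.continuous_fourierChar.comp (by fun_prop))
  have hint : Integrable (fun p : E2 × ℝ => (Real.fourierChar (-⟪p.1, ξ⟫) : ℂ) * (gS p.2 (u p.1) : ℂ))
      ((volume : Measure E2).prod (volume.restrict (Ioi 0))) := by
    rw [integrable_prod_iff]
    · constructor
      · filter_upwards with x
        exact ((gS_int (u x)).1.ofReal).const_mul _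
      · have : ∀ x : E2, ∫ s in Ioi (0:ℝ), ‖(Real.fourierChar (-⟪x, ξ⟫) : ℂ) * (gS s (u x) : ℂ)‖ = |u x| / 4 := by
          intro x
          rw [← (gS_int |u x|).2]
          refine setIntegral_congr_fun measurableSet_Ioi fun s hs => ?_
          show ‖(Real.fourierChar (-⟪x, ξ⟫) : ℂ) * (gS s (u x) : ℂ)‖ = gS s |u x|
          rw [norm_mul, Circle.norm_coe, one_mul, Complex.norm_real, Real.norm_eq_abs, gS_abs s (u x) hs]
        simp only [this]
        exact hi.abs.div_const 4
    · refine Measurable.aestronglyMeasurable ?_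
      exact (hmc.measurable.comp measurable_fst).mul (Complex.measurable_ofReal.comp hm)
  have e : 𝓕 (fun x => (u x : ℂ)) ξ = 4 * ∫ s in Ioi (0:ℝ), 𝓕 (fun x => (gS s (u x) : ℂ)) ξ := by
    simp only [Real.fourier_eq, Circle.smul_def, smul_eq_mul]
    rw [← integral_integral_swap (f := fun (x : E2) (s : ℝ) => (Real.fourierChar (-⟪x, ξ⟫) : ℂ) * (gS s (u x) : ℂ)) hint, ← integral_const_mul]
    refine integral_congr_ae (Eventually.of_forall fun x => ?_)
    simp only
    rw [integral_const_mul, integral_complex_ofReal, (gS_int (u x)).2]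
    push_cast; ring
  rw [e, enorm_mul]
  have : ‖(4:ℂ)‖ₑ = 4 := by simp [← ofReal_norm]
  rw [this]
  gcongr
  exact enorm_integral_le_lintegral_enorm _

lemma hardy_cs : ∃ C : ℝ≥0, ∀ u : E2 → ℝ, ContDiff ℝ ∞ u → HasCompactSupport u →
    ∫⁻ ξ, ‖𝓕 (fun x => (u x : ℂ)) ξ‖ₑ * ENNReal.ofReal (‖ξ‖⁻¹) ≤ C * ∫⁻ x, ‖fderiv ℝ u x‖ₑ := by
  obtain ⟨C, hC⟩ := key'
  refine ⟨4 * (C * 8), ?_⟩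
  intro u hu hus
  have hc := hu.continuous
  have hi : Integrable u := hc.integrable_of_hasCompactSupport hus
  have hD : Measurable (fun x => ‖fderiv ℝ u x‖ₑ) := (hu.continuous_fderiv (by simp)).enorm.measurable
  have hmeas : Measurable (fun p : E2 × ℝ => ‖𝓕 (fun x => (gS p.2 (u x) : ℂ)) p.1‖ₑ) := by
    refine Measurable.enorm ?_
    simp only [Real.fourier_eq, Circle.smul_def, smul_eq_mul]
    refine (StronglyMeasurable.integral_prod_right' (f := fun q : (E2 × ℝ) × E2 => (Real.fourierChar (-⟪q.2, q.1.1⟫) : ℂ) * (gS q.1.2 (u q.2) : ℂ)) ?_).measurable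
    refine Measurable.stronglyMeasurable ?_
    have h1 : Continuous (fun q : (E2 × ℝ) × E2 => (Real.fourierChar (-⟪q.2, q.1.1⟫) : ℂ)) :=
      continuous_subtype_val.comp (Real.continuous_fourierChar.comp (by fun_prop))
    have h2 : Measurable (fun q : (E2 × ℝ) × E2 => gS q.1.2 (u q.2)) := by
      unfold gS
      have := hc.measurable
      fun_prop
    exact h1.measurable.mul (Complex.measurable_ofReal.comp h2)
  have hcomp : ∀ g : ℝ → ℝ, g 0 = 0 → HasCompactSupport (fun x => g (u x)) := fun g hg => hus.comp_left hg
  have hF : ∀ s ∈ Ioi (0:ℝ), ∫⁻ ξ, ‖𝓕 (fun x => (gS s (u x) : ℂ)) ξ‖ₑ * ENNReal.ofReal (‖ξ‖⁻¹) ≤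
      C * ∫⁻ x, (ENNReal.ofReal (6 * s * u x ^ 4 / (s ^ 2 + u x ^ 2) ^ 3) + ENNReal.ofReal (2 * (|u x| / (s ^ 2 + u x ^ 2)))) * ‖fderiv ℝ u x‖ₑ := by
    intro s hs
    refine (hC (fun x => gS s (u x)) (fun x => gW s (u x)) ((gS_contDiff s hs).comp hu) (hcomp _ (by simp [gS]))
      ((gW_contDiff s hs).comp hu) (hcomp _ (by simp [gW]))
      (fun x => (gS_le_sq s _ hs).trans (gW_le_one s _ hs)) (fun x => gS_le_sq s _ hs)).trans ?_
    gcongr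
    rw [← lintegral_add_left]
    · refine lintegral_mono fun x => ?_
      rw [add_mul]
      refine add_le_add ((fderiv_comp_le _ (gS_contDiff s hs) u hu x).trans ?_)
        ((fderiv_comp_le _ (gW_contDiff s hs) u hu x).trans ?_)
      · gcongr
        exact gS_deriv s _ hs
      · gcongr
        exact gW_deriv s _ hs
    · exact ((((gS_contDiff s hs).comp hu).continuous_fderiv (by simp)).enorm).measurable
  calc _ ≤ ∫⁻ ξ : E2, (4 * ∫⁻ s in Ioi (0:ℝ), ‖𝓕 (fun x => (gS s (u x) : ℂ)) ξ‖ₑ) * ENNReal.ofReal (‖ξ‖⁻¹) := by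
        refine lintegral_mono fun ξ => ?_
        gcongr
        exact fourier_slice u hc hi ξ
    _ = 4 * ∫⁻ ξ : E2, ∫⁻ s in Ioi (0:ℝ), ‖𝓕 (fun x => (gS s (u x) : ℂ)) ξ‖ₑ * ENNReal.ofReal (‖ξ‖⁻¹) := by
        rw [← lintegral_const_mul' _ _ (by simp)]
        refine lintegral_congr fun ξ => ?_
        rw [mul_assoc, lintegral_mul_const' _ _ (by simp)]
    _ = 4 * ∫⁻ s in Ioi (0:ℝ), ∫⁻ ξ : E2, ‖𝓕 (fun x => (gS s (u x) : ℂ)) ξ‖ₑ * ENNReal.ofReal (‖ξ‖⁻¹) := by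
        rw [lintegral_lintegral_swap]
        refine Measurable.aemeasurable ?_
        exact hmeas.mul (by fun_prop : Measurable (fun p : E2 × ℝ => ENNReal.ofReal (‖p.1‖⁻¹)))
    _ ≤ 4 * ∫⁻ s in Ioi (0:ℝ), C * ∫⁻ x, (ENNReal.ofReal (6 * s * u x ^ 4 / (s ^ 2 + u x ^ 2) ^ 3) + ENNReal.ofReal (2 * (|u x| / (s ^ 2 + u x ^ 2)))) * ‖fderiv ℝ u x‖ₑ := by
        exact mul_le_mul' le_rfl (setLIntegral_mono' measurableSet_Ioi hF)
    _ = 4 * (C * ∫⁻ x, ∫⁻ s in Ioi (0:ℝ), (ENNReal.ofReal (6 * s * u x ^ 4 / (s ^ 2 + u x ^ 2) ^ 3) + ENNReal.ofReal (2 * (|u x| / (s ^ 2 + u x ^ 2)))) * ‖fderiv ℝ u x‖ₑ) := by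
        rw [lintegral_const_mul' _ _ (by simp), lintegral_lintegral_swap]
        refine Measurable.aemeasurable ?_
        have h1 : Measurable (fun p : ℝ × E2 => ENNReal.ofReal (6 * p.1 * u p.2 ^ 4 / (p.1 ^ 2 + u p.2 ^ 2) ^ 3) + ENNReal.ofReal (2 * (|u p.2| / (p.1 ^ 2 + u p.2 ^ 2)))) := by
          have := hc.measurable
          have h2 : Measurable (fun p : ℝ × E2 => |u p.2|) := (hc.abs.comp continuous_snd).measurable
          fun_prop
        exact h1.mul (hD.comp measurable_snd)
    _ ≤ 4 * (C * ∫⁻ x, 8 * ‖fderiv ℝ u x‖ₑ) := by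
        gcongr with x
        rw [lintegral_mul_const' _ _ (by simp), lintegral_add_left (by fun_prop)]
        gcongr
        refine (add_le_add (dS_int (u x)) (dW_int (u x))).trans ?_
        norm_num
    _ = _ := by
        rw [lintegral_const_mul' _ _ (by simp)]
        push_cast
        ring

/-- A smooth cutoff -/
def cutB : ContDiffBump (0 : E2) := ⟨1, 2, by norm_num, by norm_num⟩

lemma hardy : ∃ C : ℝ≥0, ∀ u : E2 → ℝ, ContDiff ℝ ∞ u → Integrable u →
    ∫⁻ ξ, ‖𝓕 (fun x => (u x : ℂ)) ξ‖ₑ * ENNReal.ofReal (‖ξ‖⁻¹) ≤ C * ∫⁻ x, ‖fderiv ℝ u x‖ₑ := by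
  obtain ⟨C, hC⟩ := hardy_cs
  refine ⟨C, ?_⟩
  intro u hu hi
  obtain ⟨K, hK⟩ : ∃ K : ℝ≥0, ∀ x, ‖fderiv ℝ cutB x‖ ≤ K := by
    have h1 : Continuous (fderiv ℝ cutB) := (cutB.contDiff (n := 1)).continuous_fderiv one_ne_zero
    have h2 : HasCompactSupport (fderiv ℝ cutB) := cutB.hasCompactSupport.fderiv ℝ
    obtain ⟨K, hK⟩ := h1.bounded_above_of_compact_support h2
    exact ⟨K.toNNReal, fun x => (hK x).trans (Real.le_coe_toNNReal K)⟩
  set r : ℕ → ℝ := fun n => ((n:ℝ) + 1)⁻¹ with hr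
  have hr0 : ∀ n, 0 < r n := fun n => by positivity
  set ζ : ℕ → E2 → ℝ := fun n x => cutB (r n • x) with hζ
  have hζd : ∀ n, ContDiff ℝ ∞ (ζ n) := fun n => cutB.contDiff.comp (contDiff_const_smul _)
  have hζs : ∀ n, HasCompactSupport (ζ n) := fun n =>
    cutB.hasCompactSupport.comp_homeomorph (Homeomorph.smulOfNeZero (r n) (hr0 n).ne')
  have hζ1 : ∀ n x, ‖ζ n x‖ ≤ 1 := fun n x => by
    rw [Real.norm_eq_abs, abs_of_nonneg (cutB.nonneg)]; exact cutB.le_one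
  have hζD : ∀ n x, ‖fderiv ℝ (ζ n) x‖ ≤ K * r n := by
    intro n x
    have h1 : HasFDerivAt (fun x : E2 => r n • x) (r n • ContinuousLinearMap.id ℝ E2) x :=
      (hasFDerivAt_id x).const_smul (r n)
    have h2 : HasFDerivAt cutB (fderiv ℝ cutB (r n • x)) (r n • x) :=
      ((cutB.contDiff (n := 1)).differentiable one_ne_zero _).hasFDerivAt
    have h3 := (h2.comp x h1).fderiv
    have h4 : fderiv ℝ (ζ n) x = r n • fderiv ℝ cutB (r n • x) := by
      refine h3.trans ?_
      ext; simp
    rw [h4, norm_smul, Real.norm_eq_abs, abs_of_pos (hr0 n), mul_comm]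
    gcongr
    exact hK _
  have hrt : Tendsto r atTop (𝓝 0) := tendsto_inv_atTop_zero.comp (tendsto_natCast_atTop_atTop.atTop_add tendsto_const_nhds)
  have hζt : ∀ x, Tendsto (fun n => ζ n x) atTop (𝓝 1) := by
    intro x
    have : Tendsto (fun n => r n • x) atTop (𝓝 ((0:ℝ) • x)) := hrt.smul_const x
    have h2 := (cutB.continuous.tendsto _).comp this
    rw [zero_smul, cutB.one_of_mem_closedBall (by simp [cutB])] at h2
    exact h2
  have hFt : ∀ ξ, Tendsto (fun n => 𝓕 (fun x => ((ζ n x * u x : ℝ) : ℂ)) ξ) atTop (𝓝 (𝓕 (fun x => (u x : ℂ)) ξ)) := by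
    intro ξ
    simp only [Real.fourier_eq]
    refine tendsto_integral_of_dominated_convergence (fun x => |u x|) ?_ hi.abs ?_ ?_
    · intro n
      refine Continuous.aestronglyMeasurable ?_
      have hmc : Continuous (fun x : E2 => Real.fourierChar (-⟪x, ξ⟫)) :=
        Real.continuous_fourierChar.comp (by fun_prop)
      refine hmc.smul ?_
      exact Complex.continuous_ofReal.comp ((hζd n).continuous.mul hu.continuous)
    · intro n
      filter_upwards with x
      rw [Circle.norm_smul, Complex.norm_real, norm_mul]
      exact mul_le_of_le_one_left (norm_nonneg _) (hζ1 n x)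
    · filter_upwards with x
      refine Tendsto.const_smul ?_ _
      refine (Complex.continuous_ofReal.tendsto _).comp ?_
      simpa using (hζt x).mul_const (u x)
  have hn : ∀ n, ∫⁻ ξ, ‖𝓕 (fun x => ((ζ n x * u x : ℝ) : ℂ)) ξ‖ₑ * ENNReal.ofReal (‖ξ‖⁻¹) ≤
      C * ((∫⁻ x, ‖fderiv ℝ u x‖ₑ) + ENNReal.ofReal (K * r n) * ∫⁻ x, ‖u x‖ₑ) := by
    intro n
    refine (hC _ ((hζd n).mul hu) ((hζs n).mul_right)).trans ?_
    gcongr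
    rw [← lintegral_const_mul' _ _ ENNReal.ofReal_ne_top, ← lintegral_add_left (hu.continuous_fderiv (by simp)).enorm.measurable]
    refine lintegral_mono fun x => ?_
    have h1 := fderiv_mul ((hζd n).differentiable (by simp) x) (hu.differentiable (by simp) x)
    have h2 : fderiv ℝ (fun x => ζ n x * u x) x = ζ n x • fderiv ℝ u x + u x • fderiv ℝ (ζ n) x := h1
    rw [h2]
    refine (enorm_clm_add _ _).trans ?_
    rw [enorm_smul, enorm_smul]
    refine add_le_add ?_ ?_
    · refine mul_le_of_le_one_left (by simp) ?_
      rw [← ofReal_norm]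
      exact ENNReal.ofReal_le_one.2 (hζ1 n x)
    · rw [mul_comm (ENNReal.ofReal _)]
      refine mul_le_mul' le_rfl ?_
      rw [← ofReal_norm]
      exact ENNReal.ofReal_le_ofReal (hζD n x)
  have hlim : Tendsto (fun n => (C:ℝ≥0∞) * ((∫⁻ x, ‖fderiv ℝ u x‖ₑ) + ENNReal.ofReal (K * r n) * ∫⁻ x, ‖u x‖ₑ)) atTop
      (𝓝 (C * ∫⁻ x, ‖fderiv ℝ u x‖ₑ)) := by
    refine ENNReal.Tendsto.const_mul ?_ (Or.inr (by simp))
    have h1 : Tendsto (fun n => ENNReal.ofReal (K * r n)) atTop (𝓝 0) := by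
      have := ENNReal.tendsto_ofReal (hrt.const_mul (K:ℝ))
      simpa using this
    have h2 := ENNReal.Tendsto.mul_const (b := ∫⁻ x, ‖u x‖ₑ) h1 (Or.inr hi.2.ne)
    simpa using h2.const_add (∫⁻ x, ‖fderiv ℝ u x‖ₑ)
  have hFc : ∀ n, Continuous (𝓕 (fun x => ((ζ n x * u x : ℝ) : ℂ))) := by
    intro n
    have h1 : Integrable (fun x => ((ζ n x * u x : ℝ) : ℂ)) :=
      (((hζd n).mul hu).continuous.integrable_of_hasCompactSupport ((hζs n).mul_right)).ofReal
    exact fourier_cont _ h1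
  calc _ = ∫⁻ ξ, liminf (fun n => ‖𝓕 (fun x => ((ζ n x * u x : ℝ) : ℂ)) ξ‖ₑ * ENNReal.ofReal (‖ξ‖⁻¹)) atTop := by
        refine lintegral_congr fun ξ => ?_
        refine (Tendsto.liminf_eq ?_).symm
        exact ENNReal.Tendsto.mul_const ((continuous_enorm.tendsto _).comp (hFt ξ)) (Or.inr (by simp))
    _ ≤ liminf (fun n => ∫⁻ ξ, ‖𝓕 (fun x => ((ζ n x * u x : ℝ) : ℂ)) ξ‖ₑ * ENNReal.ofReal (‖ξ‖⁻¹)) atTop := by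
        refine lintegral_liminf_le fun n => ?_
        exact (hFc n).enorm.measurable.mul (by fun_prop)
    _ ≤ liminf (fun n => (C:ℝ≥0∞) * ((∫⁻ x, ‖fderiv ℝ u x‖ₑ) + ENNReal.ofReal (K * r n) * ∫⁻ x, ‖u x‖ₑ)) atTop :=
        liminf_le_liminf (Eventually.of_forall hn)
    _ = _ := hlim.liminf_eq


/-- Mollification of `f` by a real kernel. -/
def molF (ψ : E2 → ℝ) (f : E2 → ℂ) : E2 → ℂ := fun x => ∫ t, f t * (ψ (x - t) : ℂ)

lemma molF_eq (ψ : E2 → ℝ) (f : E2 → ℂ) :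
    molF ψ f = convolution f (fun y => (ψ y : ℂ)) (ContinuousLinearMap.mul ℝ ℂ) volume := rfl

lemma molF_eqC (ψ : E2 → ℝ) (f : E2 → ℂ) :
    molF ψ f = convolution f (fun y => (ψ y : ℂ)) (ContinuousLinearMap.mul ℂ ℂ) volume := rfl

lemma cs_ofReal {ψ : E2 → ℝ} (hs : HasCompactSupport ψ) : HasCompactSupport (fun y => (ψ y : ℂ)) :=
  hs.comp_left (g := fun r : ℝ => (r : ℂ)) (by simp)

lemma cd_ofReal {ψ : E2 → ℝ} (hs : ContDiff ℝ ∞ ψ) : ContDiff ℝ ∞ (fun y => (ψ y : ℂ)) :=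
  Complex.ofRealCLM.contDiff.comp hs

lemma molF_contDiff {ψ : E2 → ℝ} (h1 : ContDiff ℝ ∞ ψ) (h2 : HasCompactSupport ψ) {f : E2 → ℂ}
    (hf : Integrable f) : ContDiff ℝ ∞ (molF ψ f) := by
  rw [molF_eq]
  exact (cs_ofReal h2).contDiff_convolution_right _ hf.locallyIntegrable (cd_ofReal h1)

lemma molF_integrable {ψ : E2 → ℝ} (h1 : ContDiff ℝ ∞ ψ) (h2 : HasCompactSupport ψ) {f : E2 → ℂ}
    (hf : Integrable f) : Integrable (molF ψ f) := by
  rw [molF_eq]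
  exact hf.integrable_convolution _ ((cd_ofReal h1).continuous.integrable_of_hasCompactSupport (cs_ofReal h2))

lemma molF_fourier {ψ : E2 → ℝ} (h1 : ContDiff ℝ ∞ ψ) (h2 : HasCompactSupport ψ) {f : E2 → ℂ}
    (hf : Integrable f) (ξ : E2) : 𝓕 (molF ψ f) ξ = 𝓕 f ξ * 𝓕 (fun y => (ψ y : ℂ)) ξ := by
  rw [molF_eqC]
  exact Real.fourier_mul_convolution_eq hf ((cd_ofReal h1).continuous.integrable_of_hasCompactSupport (cs_ofReal h2)) ξ

lemma molF_fderiv {ψ : E2 → ℝ} (h1 : ContDiff ℝ ∞ ψ) (h2 : HasCompactSupport ψ) {f g : E2 → ℂ}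
    (hf : Integrable f) (i : Fin 2) (hw : IsWeakPartialDerivC i f g) (x : E2) :
    fderiv ℝ (molF ψ f) x (EuclideanSpace.single i 1) = molF ψ g x := by
  have hd := (cs_ofReal h2).hasFDerivAt_convolution_right (ContinuousLinearMap.mul ℝ ℂ) hf.locallyIntegrable
    ((cd_ofReal h1).of_le (by simp)) x
  rw [molF_eq, hd.fderiv, convolution_precompR_apply _ hf.locallyIntegrable ((cs_ofReal h2).fderiv ℝ)
    ((cd_ofReal h1).continuous_fderiv (by simp))]
  have hψ : ∀ y, HasFDerivAt ψ (fderiv ℝ ψ y) y := fun y => (h1.differentiable (by simp) y).hasFDerivAt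
  have h3 : ∀ y v, fderiv ℝ (fun y => (ψ y : ℂ)) y v = (fderiv ℝ ψ y v : ℝ) := by
    intro y v
    have := (Complex.ofRealCLM.hasFDerivAt.comp y (hψ y)).fderiv
    change fderiv ℝ (fun y => (ψ y : ℂ)) y = _ at this
    rw [this]; simp
  have h4 : ∀ t v, fderiv ℝ (fun t => ψ (x - t)) t v = - fderiv ℝ ψ (x - t) v := by
    intro t v
    have h5 : HasFDerivAt (fun t : E2 => x - t) (-ContinuousLinearMap.id ℝ E2) t := (hasFDerivAt_id t).const_sub x
    have := ((hψ (x - t)).comp t h5).fderiv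
    change fderiv ℝ (fun t => ψ (x - t)) t = _ at this
    rw [this]; simp
  have h6 := hw (fun t => ψ (x - t)) (h1.comp (contDiff_const.sub contDiff_id))
    (h2.comp_homeomorph (Homeomorph.subLeft x))
  simp only [h4] at h6
  rw [convolution_def]
  simp only [ContinuousLinearMap.mul_apply', h3, molF]
  have h7 : ∫ t, f t * ((-fderiv ℝ ψ (x - t) (EuclideanSpace.single i 1) : ℝ) : ℂ) =
      -∫ t, f t * ((fderiv ℝ ψ (x - t) (EuclideanSpace.single i 1) : ℝ) : ℂ) := by
    rw [← integral_neg]; congr 1; ext t; push_cast; ring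
  rw [h7] at h6
  exact neg_injective h6

lemma molF_lint {ψ : E2 → ℝ} (h1 : ContDiff ℝ ∞ ψ) (h2 : HasCompactSupport ψ) (h0 : ∀ x, 0 ≤ ψ x)
    (hI : ∫ x, ψ x = 1) {f : E2 → ℂ} (hf : Integrable f) :
    ∫⁻ x, ‖molF ψ f x‖ₑ ≤ ∫⁻ x, ‖f x‖ₑ := by
  have hI' : ∫⁻ x, ‖(ψ x : ℂ)‖ₑ = 1 := by
    have : ∀ x, ‖(ψ x : ℂ)‖ₑ = ENNReal.ofReal (ψ x) := fun x => by
      rw [← ofReal_norm, Complex.norm_real, Real.norm_eq_abs, abs_of_nonneg (h0 x)]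
    simp only [this]
    rw [← ofReal_integral_eq_lintegral_ofReal (h1.continuous.integrable_of_hasCompactSupport h2)
      (Eventually.of_forall h0), hI, ENNReal.ofReal_one]
  have hψm : Measurable (fun x => ‖(ψ x : ℂ)‖ₑ) := (cd_ofReal h1).continuous.enorm.measurable
  calc _ ≤ ∫⁻ x, ∫⁻ t, ‖f t‖ₑ * ‖(ψ (x - t) : ℂ)‖ₑ := by
        refine lintegral_mono fun x => ?_
        refine (enorm_integral_le_lintegral_enorm _).trans ?_
        simp only [enorm_mul]; exact le_rfl
    _ = ∫⁻ t, ∫⁻ x, ‖f t‖ₑ * ‖(ψ (x - t) : ℂ)‖ₑ := by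
        refine lintegral_lintegral_swap ?_
        have m1 : AEMeasurable (fun p : E2 × E2 => ‖f p.2‖ₑ) (volume.prod volume) := hf.1.enorm.comp_snd
        have m2 : AEMeasurable (fun p : E2 × E2 => ‖(ψ (p.1 - p.2) : ℂ)‖ₑ) (volume.prod volume) :=
          (hψm.comp (measurable_fst.sub measurable_snd)).aemeasurable
        exact m1.mul m2
    _ = ∫⁻ t, ‖f t‖ₑ := by
        refine lintegral_congr fun t => ?_
        have m3 : Measurable (fun x : E2 => ‖(ψ (x - t) : ℂ)‖ₑ) := hψm.comp (measurable_id.sub_const t)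
        rw [lintegral_const_mul _ m3,
          lintegral_sub_right_eq_self (fun x => ‖(ψ x : ℂ)‖ₑ) t, hI', mul_one]

/-- shrinking bumps -/
def bmp (n : ℕ) : ContDiffBump (0 : E2) :=
  ⟨((n:ℝ) + 1)⁻¹ / 2, ((n:ℝ) + 1)⁻¹, by positivity, half_lt_self (by positivity)⟩

lemma bmp_fourier (ξ : E2) :
    Tendsto (fun n => 𝓕 (fun y => (((bmp n).normed volume y : ℝ) : ℂ)) ξ) atTop (𝓝 1) := by
  have hmc : Continuous (fun x : E2 => (Real.fourierChar (⟪x, ξ⟫) : ℂ)) :=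
    continuous_subtype_val.comp (Real.continuous_fourierChar.comp (by fun_prop))
  have hr : Tendsto (fun n => (bmp n).rOut) atTop (𝓝 0) :=
    tendsto_inv_atTop_zero.comp (tendsto_natCast_atTop_atTop.atTop_add tendsto_const_nhds)
  have h := ContDiffBump.convolution_tendsto_right_of_continuous (μ := (volume : Measure E2)) hr hmc 0
  have e : ((Real.fourierChar (⟪(0:E2), ξ⟫) : Circle) : ℂ) = 1 := by simp
  rw [e] at h
  refine h.congr fun n => ?_
  rw [convolution_def, Real.fourier_eq]
  congr 1
  ext t
  simp [Circle.smul_def, mul_comm]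

lemma clm_le {F : Type*} [NormedAddCommGroup F] [NormedSpace ℝ F] (L : E2 →L[ℝ] F) :
    ‖L‖ ≤ ∑ j, ‖L (EuclideanSpace.single j 1)‖ := by
  refine L.opNorm_le_bound (by positivity) fun v => ?_
  have hv : v = ∑ j, v j • EuclideanSpace.single j (1:ℝ) := by
    ext k; fin_cases k <;> simp [Fin.sum_univ_two]
  conv_lhs => rw [hv]
  rw [map_sum, Finset.sum_mul]
  refine (norm_sum_le _ _).trans (Finset.sum_le_sum fun j _ => ?_)
  rw [map_smul, norm_smul, mul_comm]
  gcongr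
  exact PiLp.norm_apply_le v j

lemma norm_E2_le (v : E2) : ‖v‖ ≤ ∑ j, |v j| := by
  have hv : v = ∑ j, v j • EuclideanSpace.single j (1:ℝ) := by
    ext k; fin_cases k <;> simp [Fin.sum_univ_two]
  conv_lhs => rw [hv]
  refine (norm_sum_le _ _).trans (Finset.sum_le_sum fun j _ => ?_)
  rw [norm_smul]; simp

/-- Hardy for complex functions -/
lemma hardyC : ∃ C : ℝ≥0, ∀ u : E2 → ℂ, ContDiff ℝ ∞ u → Integrable u →
    ∫⁻ ξ, ‖𝓕 u ξ‖ₑ * ENNReal.ofReal (‖ξ‖⁻¹) ≤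
      C * ∑ j, ∫⁻ x, ‖fderiv ℝ u x (EuclideanSpace.single j 1)‖ₑ := by
  obtain ⟨C, hC⟩ := hardy
  refine ⟨2 * C, fun u hu hi => ?_⟩
  have hre : ContDiff ℝ ∞ (fun x => (u x).re) := Complex.reCLM.contDiff.comp hu
  have him : ContDiff ℝ ∞ (fun x => (u x).im) := Complex.imCLM.contDiff.comp hu
  have hcl : ∀ (l : ℂ →L[ℝ] ℝ), (∀ z, ‖l z‖ ≤ ‖z‖) → ∫⁻ x, ‖fderiv ℝ (fun x => l (u x)) x‖ₑ ≤
      ∑ j, ∫⁻ x, ‖fderiv ℝ u x (EuclideanSpace.single j 1)‖ₑ := by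
    intro l hl
    rw [← lintegral_finsetSum]
    · refine lintegral_mono fun x => ?_
      have h1 := (l.hasFDerivAt.comp x (hu.differentiable (by simp) x).hasFDerivAt).fderiv
      have h2 : fderiv ℝ (fun x => l (u x)) x = l.comp (fderiv ℝ u x) := h1
      rw [h2, ← ofReal_norm]
      simp only [← ofReal_norm]
      rw [← ENNReal.ofReal_sum_of_nonneg (fun _ _ => norm_nonneg _)]
      refine ENNReal.ofReal_le_ofReal ((clm_le _).trans (Finset.sum_le_sum fun j _ => ?_))
      exact hl _
    · intro j _
      exact ((hu.continuous_fderiv (by simp)).clm_apply continuous_const).enorm.measurable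
  have hF : ∀ ξ, 𝓕 u ξ = 𝓕 (fun x => ((u x).re : ℂ)) ξ + Complex.I * 𝓕 (fun x => ((u x).im : ℂ)) ξ := by
    intro ξ
    simp only [Real.fourier_eq]
    have i1 : Integrable (fun x => ((u x).re : ℂ)) := hi.re.ofReal
    have i2 : Integrable (fun x => ((u x).im : ℂ)) := hi.im.ofReal
    rw [← integral_const_mul, ← integral_add]
    · congr 1; ext x
      rw [Circle.smul_def, Circle.smul_def, Circle.smul_def]
      conv_lhs => rw [← Complex.re_add_im (u x)]
      simp only [smul_eq_mul]; ring
    · exact (Real.fourierIntegral_convergent_iff ξ).2 i1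
    · exact ((Real.fourierIntegral_convergent_iff ξ).2 i2).const_mul _
  have hc := fourier_cont _ (hi.re.ofReal (𝕜 := ℂ))
  calc _ ≤ ∫⁻ ξ, (‖𝓕 (fun x => ((u x).re : ℂ)) ξ‖ₑ * ENNReal.ofReal (‖ξ‖⁻¹) +
        ‖𝓕 (fun x => ((u x).im : ℂ)) ξ‖ₑ * ENNReal.ofReal (‖ξ‖⁻¹)) := by
        refine lintegral_mono fun ξ => ?_
        rw [← add_mul]
        gcongr
        rw [hF]
        refine (enorm_add_le _ _).trans ?_
        rw [enorm_mul]
        simp [← ofReal_norm Complex.I]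
    _ = _ := lintegral_add_left (hc.enorm.measurable.mul (by fun_prop)) _
    _ ≤ C * (∑ j, ∫⁻ x, ‖fderiv ℝ u x (EuclideanSpace.single j 1)‖ₑ) +
        C * (∑ j, ∫⁻ x, ‖fderiv ℝ u x (EuclideanSpace.single j 1)‖ₑ) := by
        refine add_le_add ((hC _ hre hi.re).trans ?_) ((hC _ him hi.im).trans ?_)
        · exact mul_le_mul' le_rfl (hcl Complex.reCLM (fun z => Complex.abs_re_le_norm z))
        · exact mul_le_mul' le_rfl (hcl Complex.imCLM (fun z => Complex.abs_im_le_norm z))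
    _ = _ := by push_cast; ring

lemma fourier_div (F : E2 → ℂ) (hF : ContDiff ℝ ∞ F) (hi : Integrable F) (G : Fin 2 → E2 → ℂ)
    (hG : ∀ i x, fderiv ℝ F x (EuclideanSpace.single i 1) = G i x) (hGi : ∀ i, Integrable (G i)) (ξ : E2)
    (hξ : ξ ≠ 0) : ‖𝓕 F ξ‖ₑ ≤ ∑ i, ‖𝓕 (G i) ξ‖ₑ * ENNReal.ofReal (‖ξ‖⁻¹) := by
  have hfi : Integrable (fderiv ℝ F) := by
    refine Integrable.mono' (g := fun x => ∑ i, ‖G i x‖) (integrable_finsetSum _ fun i _ => (hGi i).norm)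
      (hF.continuous_fderiv (by simp)).aestronglyMeasurable (Eventually.of_forall fun x => ?_)
    simpa only [hG] using clm_le (fderiv ℝ F x)
  have h1 := Real.fourier_fderiv hi (hF.differentiable (by simp)) hfi
  have h2 : ∀ i, |ξ i| * ‖𝓕 F ξ‖ ≤ ‖𝓕 (G i) ξ‖ := by
    intro i
    have h3 := congrArg (fun L => L (EuclideanSpace.single i 1)) (congrFun h1 ξ)
    rw [Real.fourier_continuousLinearMap_apply hfi] at h3
    simp only [hG] at h3
    have h4 : 𝓕 (G i) ξ = _ := h3
    rw [h4]
    simp [VectorFourier.fourierSMulRight_apply]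
    have h9 : (1:ℝ) ≤ 2 * |Real.pi| := by rw [abs_of_pos Real.pi_pos]; linarith [Real.two_le_pi]
    have h8 : 0 ≤ |ξ i| * ‖𝓕 F ξ‖ := by positivity
    have h10 : (innerSL ℝ ξ) (EuclideanSpace.single i 1) = ξ i := by
      rw [innerSL_apply_apply]; simp [EuclideanSpace.inner_single_right]
    rw [h10]
    exact le_mul_of_one_le_left h8 h9
  have hp : 0 < ‖ξ‖ := norm_pos_iff.2 hξ
  have h5 : ‖𝓕 F ξ‖ ≤ ∑ i, ‖𝓕 (G i) ξ‖ * ‖ξ‖⁻¹ := by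
    rw [← Finset.sum_mul, ← div_eq_mul_inv, le_div_iff₀ hp]
    calc _ ≤ ‖𝓕 F ξ‖ * ∑ j, |ξ j| := by gcongr; exact norm_E2_le ξ
      _ = ∑ j, |ξ j| * ‖𝓕 F ξ‖ := by rw [mul_comm, Finset.sum_mul]
      _ ≤ _ := Finset.sum_le_sum fun i _ => h2 i
  simp only [← ofReal_norm]
  simp only [← ENNReal.ofReal_mul (norm_nonneg _)]
  rw [← ENNReal.ofReal_sum_of_nonneg (fun _ _ => by positivity)]
  exact ENNReal.ofReal_le_ofReal h5

lemma main_lint : ∃ C : ℝ≥0, ∀ (f : E2 → ℂ) (g : Fin 2 → E2 → ℂ) (h : Fin 2 → Fin 2 → E2 → ℂ),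
    Integrable f →
    (∀ i, IsWeakPartialDerivC i f (g i) ∧ Integrable (g i)) →
    (∀ i j, IsWeakPartialDerivC j (g i) (h i j) ∧ Integrable (h i j)) →
    ∫⁻ ξ, ‖𝓕 f ξ‖ₑ ≤ C * ∑ i, ∑ j, ∫⁻ x, ‖h i j x‖ₑ := by
  obtain ⟨C, hC⟩ := hardyC
  refine ⟨C, fun f g h hf hg hh => ?_⟩
  set ψ : ℕ → E2 → ℝ := fun n => (bmp n).normed volume with hψ
  have h1 : ∀ n, ContDiff ℝ ∞ (ψ n) := fun n => (bmp n).contDiff_normed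
  have h2 : ∀ n, HasCompactSupport (ψ n) := fun n => (bmp n).hasCompactSupport_normed
  have h0 : ∀ n x, 0 ≤ ψ n x := fun n x => (bmp n).nonneg_normed x
  have hI : ∀ n, ∫ x, ψ n x = 1 := fun n => (bmp n).integral_normed
  have hn : ∀ n, ∫⁻ ξ, ‖𝓕 (molF (ψ n) f) ξ‖ₑ ≤ C * ∑ i, ∑ j, ∫⁻ x, ‖h i j x‖ₑ := by
    intro n
    have hae : ∀ᵐ ξ : E2, ξ ≠ 0 := by simp [ae_iff, measure_singleton]
    calc _ ≤ ∫⁻ ξ, ∑ i, ‖𝓕 (molF (ψ n) (g i)) ξ‖ₑ * ENNReal.ofReal (‖ξ‖⁻¹) := by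
          refine lintegral_mono_ae (hae.mono fun ξ hξ => ?_)
          exact fourier_div _ (molF_contDiff (h1 n) (h2 n) hf) (molF_integrable (h1 n) (h2 n) hf)
            (fun i => molF (ψ n) (g i)) (fun i x => molF_fderiv (h1 n) (h2 n) hf i (hg i).1 x)
            (fun i => molF_integrable (h1 n) (h2 n) (hg i).2) ξ hξ
      _ = ∑ i, ∫⁻ ξ, ‖𝓕 (molF (ψ n) (g i)) ξ‖ₑ * ENNReal.ofReal (‖ξ‖⁻¹) := by
          refine lintegral_finsetSum _ fun i _ => ?_
          exact (fourier_cont _ (molF_integrable (h1 n) (h2 n) (hg i).2)).enorm.measurable.mul (by fun_prop)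
      _ ≤ ∑ i, C * ∑ j, ∫⁻ x, ‖h i j x‖ₑ := by
          refine Finset.sum_le_sum fun i _ => ?_
          refine (hC _ (molF_contDiff (h1 n) (h2 n) (hg i).2) (molF_integrable (h1 n) (h2 n) (hg i).2)).trans ?_
          refine mul_le_mul' le_rfl (Finset.sum_le_sum fun j _ => ?_)
          simp only [molF_fderiv (h1 n) (h2 n) (hg i).2 j (hh i j).1]
          exact molF_lint (h1 n) (h2 n) (h0 n) (hI n) (hh i j).2
      _ = _ := by rw [Finset.mul_sum]
  have hFt : ∀ ξ, Tendsto (fun n => 𝓕 (molF (ψ n) f) ξ) atTop (𝓝 (𝓕 f ξ)) := by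
    intro ξ
    simp only [fun n => molF_fourier (h1 n) (h2 n) hf ξ]
    simpa using (bmp_fourier ξ).const_mul (𝓕 f ξ)
  calc _ = ∫⁻ ξ, liminf (fun n => ‖𝓕 (molF (ψ n) f) ξ‖ₑ) atTop := by
        refine lintegral_congr fun ξ => ?_
        refine (Tendsto.liminf_eq ?_).symm
        exact (continuous_enorm.tendsto _).comp (hFt ξ)
    _ ≤ liminf (fun n => ∫⁻ ξ, ‖𝓕 (molF (ψ n) f) ξ‖ₑ) atTop := by
        refine lintegral_liminf_le fun n => ?_
        exact (fourier_cont _ (molF_integrable (h1 n) (h2 n) hf)).enorm.measurable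
    _ ≤ liminf (fun n : ℕ => (C:ℝ≥0∞) * ∑ i, ∑ j, ∫⁻ x, ‖h i j x‖ₑ) atTop :=
        liminf_le_liminf (Eventually.of_forall hn)
    _ = _ := by simp

lemma fourierT_eq (f : E2 → ℂ) (ξ : E2) : fourierT f ξ = 𝓕 f ((2 * Real.pi)⁻¹ • ξ) := by
  rw [fourierT, Real.fourier_eq]
  congr 1; ext x
  rw [Circle.smul_def, Real.fourierChar_apply, smul_eq_mul, inner_smul_right, real_inner_comm]
  congr 2
  have : (Real.pi : ℂ) ≠ 0 := by exact_mod_cast Real.pi_ne_zero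
  push_cast
  field_simp

theorem stmt0 :
    ∃ C : ℝ, 0 < C ∧
      ∀ (f : E2 → ℂ) (g : Fin 2 → E2 → ℂ) (h : Fin 2 → Fin 2 → E2 → ℂ),
        Integrable f →
        (∀ i, IsWeakPartialDerivC i f (g i) ∧ Integrable (g i)) →
        (∀ i j, IsWeakPartialDerivC j (g i) (h i j) ∧ Integrable (h i j)) →
        Integrable (fourierT f) ∧
          (∫ ξ, ‖fourierT f ξ‖) ≤
            C * ((∫ x, ‖f x‖) + (∑ i, ∫ x, ‖g i x‖) + ∑ i, ∑ j, ∫ x, ‖h i j x‖) := by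
  obtain ⟨C, hC⟩ := main_lint
  refine ⟨(2 * Real.pi) ^ 2 * C + 1, by positivity, fun f g h hf hg hh => ?_⟩
  have hb := hC f g h hf hg hh
  set H : ℝ := ∑ i, ∑ j, ∫ x, ‖h i j x‖ with hH
  have hHn : 0 ≤ H := Finset.sum_nonneg fun i _ => Finset.sum_nonneg fun j _ => integral_nonneg fun x => norm_nonneg _
  have hHe : ∑ i, ∑ j, ∫⁻ x, ‖h i j x‖ₑ = ENNReal.ofReal H := by
    rw [hH, ENNReal.ofReal_sum_of_nonneg (fun i _ => Finset.sum_nonneg fun j _ => integral_nonneg fun x => norm_nonneg _)]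
    refine Finset.sum_congr rfl fun i _ => ?_
    rw [ENNReal.ofReal_sum_of_nonneg (fun j _ => integral_nonneg fun x => norm_nonneg _)]
    exact Finset.sum_congr rfl fun j _ => (ofReal_integral_norm_eq_lintegral_enorm (hh i j).2).symm
  rw [hHe] at hb
  have hFi : Integrable (𝓕 f) :=
    ⟨(fourier_cont f hf).aestronglyMeasurable, hb.trans_lt (ENNReal.mul_lt_top (by simp) (by simp))⟩
  have hFn : ∫ ξ, ‖𝓕 f ξ‖ ≤ C * H := by
    rw [← ofReal_integral_norm_eq_lintegral_enorm hFi, ← ENNReal.ofReal_coe_nnreal, ← ENNReal.ofReal_mul (by positivity)] at hb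
    exact (ENNReal.ofReal_le_ofReal_iff (by positivity)).1 hb
  have hp : (2 * Real.pi)⁻¹ ≠ 0 := by positivity
  have he : fourierT f = fun ξ => 𝓕 f ((2 * Real.pi)⁻¹ • ξ) := funext (fourierT_eq f)
  have hfn : 0 ≤ ∫ x, ‖f x‖ := integral_nonneg fun x => norm_nonneg _
  have hgn : 0 ≤ ∑ i, ∫ x, ‖g i x‖ := Finset.sum_nonneg fun i _ => integral_nonneg fun x => norm_nonneg _
  constructor
  · rw [he]
    exact hFi.comp_smul hp
  · rw [he]
    rw [Measure.integral_comp_smul volume (fun ξ => ‖𝓕 f ξ‖)]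
    have hfr : Module.finrank ℝ E2 = 2 := by simp
    rw [hfr, ← inv_pow, inv_inv, abs_of_pos (by positivity), smul_eq_mul]
    calc _ ≤ (2 * Real.pi) ^ 2 * (C * H) := by gcongr
      _ = ((2 * Real.pi) ^ 2 * C) * H := by ring
      _ ≤ ((2 * Real.pi) ^ 2 * C + 1) * ((∫ x, ‖f x‖) + (∑ i, ∫ x, ‖g i x‖) + H) := by
        gcongr
        · linarith
        · linarith
end
end

section
/- Let D ⊂ ℝ² be a bounded open set, 1 < p < +∞, and let W : ℝ → [0,+∞) be continuous with W(t) = 0 if and only if t ∈ {0,1}. Let P_ε(u) = (c_p/(p'ε)) ∫_D W(u) + (c_p ε^{p−1}/p) ∫_D |∇u|^p for u ∈ W^{1,p}₀(D), where p' is the conjugate exponent of p and c_p = (∫₀¹ W(s)^{1/p'} ds)^{−1}. Then for every constant C > 0 and every ε₀ > 0, any family {u_ε}_{0<ε≤ε₀} of functions u_ε ∈ W^{1,p}₀(D) with 0 ≤ u_ε ≤ 1 almost everywhere and P_ε(u_ε) ≤ C for all ε ∈ (0, ε₀] is precompact in L¹(D): every sequence ε_n → 0⁺ admits a subsequence along which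 u_{ε_n} converges in L¹(D). -/
open MeasureTheory Metric Set Filter

noncomputable section

/-- `g` is the weak partial derivative of `f` in the direction of the `i`-th coordinate:
integration by parts against smooth compactly supported test functions. -/
def IsWeakPartialDeriv (i : Fin 2) (f g : E2 → ℝ) : Prop :=
  ∀ φ : E2 → ℝ, ContDiff ℝ (⊤ : ℕ∞) φ → HasCompactSupport φ →
    ∫ x, f x * fderiv ℝ φ x (EuclideanSpace.single i 1) = -∫ x, g x * φ x

lemma pairing_exists {α : Type*} [MeasurableSpace α] {μ : Measure α} (w : α → ℝ) (M : ℝ)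
    (hM0 : 0 ≤ M) (hw : Measurable w) (hM : ∀ x, |w x| ≤ M) :
    ∃ T : StrongDual ℝ (Lp ℝ 1 μ), ‖T‖ ≤ M ∧ ∀ f : Lp ℝ 1 μ, T f = ∫ x, w x * f x ∂μ := by
  have hint : ∀ (f : α → ℝ), Integrable f μ → Integrable (fun x => w x * f x) μ := by
    intro f hf
    exact hf.bdd_mul (c := M) hw.aestronglyMeasurable (Eventually.of_forall hM)
  let T0 : Lp ℝ 1 μ →ₗ[ℝ] ℝ :=
      { toFun := fun f => ∫ x, w x * f x ∂μ
        map_add' := by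
          intro f g
          rw [← integral_add (hint _ (L1.integrable_coeFn f)) (hint _ (L1.integrable_coeFn g))]
          apply integral_congr_ae
          filter_upwards [Lp.coeFn_add f g] with x hx
          rw [hx, Pi.add_apply, mul_add]
        map_smul' := by
          intro c f
          rw [RingHom.id_apply, smul_eq_mul, ← integral_const_mul]
          apply integral_congr_ae
          filter_upwards [Lp.coeFn_smul c f] with x hx
          rw [hx, Pi.smul_apply, smul_eq_mul]; ring }
  have hb : ∀ f : Lp ℝ 1 μ, ‖T0 f‖ ≤ M * ‖f‖ := by
    intro f
    rw [L1.norm_eq_integral_norm, ← integral_const_mul]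
    change ‖∫ x, w x * f x ∂μ‖ ≤ _
    apply norm_integral_le_of_norm_le ((L1.integrable_coeFn f).norm.const_mul M)
    refine Eventually.of_forall fun x => ?_
    rw [norm_mul]
    exact mul_le_mul_of_nonneg_right (hM x) (norm_nonneg _)
  exact ⟨T0.mkContinuous M hb, LinearMap.mkContinuous_norm_le _ hM0 _, fun f => rfl⟩

lemma weak_subseq (w : ℕ → E2 → ℝ) (M : ℝ) (hw : ∀ n, Measurable (w n))
    (hM : ∀ n x, |w n x| ≤ M) :
    ∃ ns : ℕ → ℕ, StrictMono ns ∧ ∀ f : E2 → ℝ, Integrable f →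
      ∃ l : ℝ, Tendsto (fun k => ∫ x, w (ns k) x * f x) atTop (nhds l) := by
  have hM0 : 0 ≤ M := (abs_nonneg _).trans (hM 0 0)
  have : Fact ((1:ENNReal) ≠ ⊤) := ⟨by simp⟩
  choose T hTn hTf using fun n =>
    pairing_exists (μ := (volume : Measure E2)) (w n) M hM0 (hw n) (hM n)
  have hT : ∀ n, StrongDual.toWeakDual (T n) ∈
      (WeakDual.toStrongDual ⁻¹' Metric.closedBall (0 : StrongDual ℝ (Lp ℝ 1 (volume : Measure E2))) M) := by
    intro n
    rw [mem_preimage, mem_closedBall, dist_zero_right]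
    exact hTn n
  obtain ⟨a, -, ns, hns, hlim⟩ := WeakDual.isSeqCompact_closedBall ℝ _ 0 M hT
  refine ⟨ns, hns, fun f hf => ⟨a (hf.toL1 f), ?_⟩⟩
  have h1 := ((WeakDual.eval_continuous (𝕜 := ℝ) (hf.toL1 f)).tendsto a).comp hlim
  refine h1.congr fun k => ?_
  refine (hTf (ns k) (hf.toL1 f)).trans ?_
  apply integral_congr_ae
  filter_upwards [hf.coeFn_toL1] with x hx
  rw [hx]

lemma l1_compact (w : ℕ → E2 → ℝ) (M R : ℝ) (L : NNReal) (hw : ∀ n, Measurable (w n))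
    (hM : ∀ n x, |w n x| ≤ M) (hR : ∀ n x, x ∉ ball (0 : E2) R → w n x = 0)
    (hL : ∀ n h, ∫⁻ x, ‖w n (x + h) - w n x‖ₑ ≤ L * ‖h‖ₑ) :
    ∃ (ns : ℕ → ℕ) (v : E2 → ℝ), StrictMono ns ∧
      ∀ᵐ x, Tendsto (fun k => w (ns k) x) atTop (nhds (v x)) := by
  obtain ⟨ns, hns, hweak⟩ := weak_subseq w M hw hM
  have hM0 : 0 ≤ M := (abs_nonneg _).trans (hM 0 0)
  have hwi : ∀ n, Integrable (w n) := by
    intro n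
    have h1 : Integrable ((ball (0:E2) R).indicator (fun _ => M)) :=
      (integrable_indicator_iff measurableSet_ball).2 (integrableOn_const (measure_ball_lt_top.ne))
    refine h1.mono' (hw n).aestronglyMeasurable (Eventually.of_forall fun x => ?_)
    by_cases hx : x ∈ ball (0:E2) R
    · simpa [indicator_of_mem hx] using hM n x
    · simp [indicator_of_notMem hx, hR n x hx]
  -- key estimate
  have key : ∀ δ : ℝ, 0 < δ → ∃ N, ∀ k ≥ N, ∀ l ≥ N,
      ∫⁻ x, edist (w (ns k) x) (w (ns l) x) ≤ 4 * (L * ENNReal.ofReal δ + ENNReal.ofReal δ) := by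
    intro δ hδ
    set V : ENNReal := volume (ball (0:E2) δ) with hV
    have hV0 : V ≠ 0 := (measure_ball_pos _ _ hδ).ne'
    have hVt : V ≠ ⊤ := measure_ball_lt_top.ne
    let A : ℕ → E2 → ℝ := fun n x => ∫ y in ball (0:E2) δ, w n (x + y)
    have hAm : ∀ n, StronglyMeasurable (A n) := by
      intro n
      have : StronglyMeasurable (Function.uncurry fun (x y : E2) => w n (x + y)) :=
        ((hw n).comp (measurable_fst.add measurable_snd)).stronglyMeasurable
      exact this.integral_prod_right
    have hAlim : ∀ x, ∃ a, Tendsto (fun k => A (ns k) x) atTop (nhds a) := by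
      intro x
      obtain ⟨l, hl⟩ := hweak ((ball x δ).indicator (fun _ => (1:ℝ)))
        ((integrable_indicator_iff measurableSet_ball).2 (integrableOn_const (measure_ball_lt_top.ne)))
      refine ⟨l, hl.congr fun k => ?_⟩
      simp only [A]
      rw [← integral_indicator measurableSet_ball, ← integral_add_left_eq_self _ x]
      congr 1
      ext y
      by_cases hy : y ∈ ball (0:E2) δ
      · have : x + y ∈ ball x δ := by simpa using hy
        simp [indicator_of_mem hy, indicator_of_mem this]
      · have : x + y ∉ ball x δ := by simpa using hy
        simp [indicator_of_notMem hy, indicator_of_notMem this]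
    choose a ha using hAlim
    have hA1 : ∀ n, ∫⁻ x, ‖A n x - V.toReal * w n x‖ₑ ≤ V * (L * ENNReal.ofReal δ) := by
      intro n
      calc ∫⁻ x, ‖A n x - V.toReal * w n x‖ₑ
          ≤ ∫⁻ x, ∫⁻ y in ball (0:E2) δ, ‖w n (x + y) - w n x‖ₑ := by
            apply lintegral_mono
            intro x
            have : A n x - V.toReal * w n x = ∫ y in ball (0:E2) δ, (w n (x + y) - w n x) := by
              rw [integral_sub]
              · simp [A, hV, Measure.real]
              · exact ((hwi n).comp_add_left x).integrableOn
              · exact integrableOn_const (measure_ball_lt_top.ne)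
            simp only [this]
            exact enorm_integral_le_lintegral_enorm _
        _ = ∫⁻ y in ball (0:E2) δ, ∫⁻ x, ‖w n (x + y) - w n x‖ₑ := by
            apply lintegral_lintegral_swap
            apply Measurable.aemeasurable
            exact (((hw n).comp (measurable_fst.add measurable_snd)).sub
              ((hw n).comp measurable_fst)).enorm
        _ ≤ ∫⁻ y in ball (0:E2) δ, L * ENNReal.ofReal δ := by
            apply setLIntegral_mono measurable_const
            intro y hy
            refine (hL n y).trans ?_
            gcongr
            rw [← ofReal_norm]
            apply ENNReal.ofReal_le_ofReal
            exact (mem_ball_zero_iff.1 hy).le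
        _ = V * (L * ENNReal.ofReal δ) := by
            rw [lintegral_const, mul_comm]; simp [hV]
    have hA2 : Tendsto (fun k => ∫⁻ x, ‖A (ns k) x - a x‖ₑ) atTop (nhds 0) := by
      have ham : Measurable a := measurable_of_tendsto_metrizable
        (fun k => (hAm (ns k)).measurable) (tendsto_pi_nhds.2 ha)
      have hAb : ∀ n x, |A n x| ≤ (ball (0:E2) (R + δ)).indicator (fun _ => M * V.toReal) x := by
        intro n x
        by_cases hx : x ∈ ball (0:E2) (R + δ)
        · rw [indicator_of_mem hx]
          exact norm_setIntegral_le_of_norm_le_const (f := fun y => w n (x + y))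
            measure_ball_lt_top (fun y _ => hM n (x + y))
        · rw [indicator_of_notMem hx]
          have : A n x = 0 := by
            apply setIntegral_eq_zero_of_forall_eq_zero
            intro y hy
            apply hR
            simp only [mem_ball_zero_iff, not_lt] at hx hy ⊢
            have := norm_sub_le (x + y) y
            simp only [add_sub_cancel_right] at this
            linarith
          simp [this]
      have hab : ∀ x, |a x| ≤ (ball (0:E2) (R + δ)).indicator (fun _ => M * V.toReal) x := by
        intro x
        exact le_of_tendsto' (ha x).abs (fun k => hAb _ x)
      have := tendsto_lintegral_of_dominated_convergence (μ := (volume : Measure E2))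
        (F := fun k x => ‖A (ns k) x - a x‖ₑ) (f := fun _ => 0)
        ((ball (0:E2) (R + δ)).indicator (fun _ => ENNReal.ofReal (2 * (M * V.toReal))))
        (fun k => ((hAm (ns k)).measurable.sub ham).enorm) ?_ ?_ ?_
      · simpa using this
      · intro k
        refine Eventually.of_forall fun x => ?_
        have h1 := hAb (ns k) x
        have h2 := hab x
        have h3 := abs_sub (A (ns k) x) (a x)
        change ‖A (ns k) x - a x‖ₑ ≤ _
        rw [← ofReal_norm, Real.norm_eq_abs]
        by_cases hx : x ∈ ball (0:E2) (R + δ)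
        · rw [indicator_of_mem hx] at *
          apply ENNReal.ofReal_le_ofReal
          linarith
        · rw [indicator_of_notMem hx] at *
          rw [ENNReal.ofReal_eq_zero.2 (by linarith)]
      · rw [lintegral_indicator measurableSet_ball, lintegral_const]
        exact ENNReal.mul_ne_top ENNReal.ofReal_ne_top (by
          rw [Measure.restrict_apply_univ]; exact measure_ball_lt_top.ne)
      · refine Eventually.of_forall fun x => ?_
        have := ((ha x).sub_const (a x)).enorm
        simpa using this
    have hpos : 0 < V * ENNReal.ofReal δ := ENNReal.mul_pos hV0 (by simpa using hδ)
    obtain ⟨N, hN⟩ := eventually_atTop.1 (hA2.eventually (gt_mem_nhds hpos))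
    have ham : Measurable a := measurable_of_tendsto_metrizable
        (fun k => (hAm (ns k)).measurable) (tendsto_pi_nhds.2 ha)
    have hone : ∀ k ≥ N, ∫⁻ x, ‖V.toReal * w (ns k) x - a x‖ₑ ≤
        V * (L * ENNReal.ofReal δ + ENNReal.ofReal δ) := by
      intro k hk
      calc ∫⁻ x, ‖V.toReal * w (ns k) x - a x‖ₑ
          ≤ ∫⁻ x, (‖A (ns k) x - V.toReal * w (ns k) x‖ₑ + ‖A (ns k) x - a x‖ₑ) := by
            apply lintegral_mono
            intro x
            simp only [← edist_eq_enorm_sub]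
            exact edist_triangle_left _ _ _
        _ = (∫⁻ x, ‖A (ns k) x - V.toReal * w (ns k) x‖ₑ) + ∫⁻ x, ‖A (ns k) x - a x‖ₑ := by
            apply lintegral_add_right
            exact ((hAm _).measurable.sub ham).enorm
        _ ≤ V * (L * ENNReal.ofReal δ) + V * ENNReal.ofReal δ := add_le_add (hA1 _) (hN k hk).le
        _ = _ := by ring
    refine ⟨N, fun k hk l hl => ?_⟩
    have h5 : V * ∫⁻ x, edist (w (ns k) x) (w (ns l) x) ≤
        V * (2 * (L * ENNReal.ofReal δ + ENNReal.ofReal δ)) := by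
      calc V * ∫⁻ x, edist (w (ns k) x) (w (ns l) x)
          = ∫⁻ x, V * edist (w (ns k) x) (w (ns l) x) := by
            rw [lintegral_const_mul]
            exact (hw _).edist (hw _)
        _ ≤ ∫⁻ x, (‖V.toReal * w (ns k) x - a x‖ₑ + ‖V.toReal * w (ns l) x - a x‖ₑ) := by
            apply lintegral_mono
            intro x
            have : V * edist (w (ns k) x) (w (ns l) x) =
                edist (V.toReal * w (ns k) x) (V.toReal * w (ns l) x) := by
              rw [edist_eq_enorm_sub, edist_eq_enorm_sub, ← mul_sub, enorm_mul]
              congr 1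
              rw [Real.enorm_eq_ofReal ENNReal.toReal_nonneg, ENNReal.ofReal_toReal hVt]
            simp only [this, ← edist_eq_enorm_sub]
            exact edist_triangle_right _ _ _
        _ = (∫⁻ x, ‖V.toReal * w (ns k) x - a x‖ₑ) + ∫⁻ x, ‖V.toReal * w (ns l) x - a x‖ₑ := by
            apply lintegral_add_right
            exact (((hw _).const_mul _).sub ham).enorm
        _ ≤ _ := add_le_add (hone k hk) (hone l hl)
        _ = _ := by ring
    rw [ENNReal.mul_le_mul_iff_right hV0 hVt] at h5
    refine h5.trans ?_
    gcongr
    norm_num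
  have hcau : CauchySeq (fun k => (hwi (ns k)).toL1 (w (ns k))) := by
    rw [EMetric.cauchySeq_iff]
    intro ε hε
    have hlim : Tendsto (fun δ : ℝ => 4 * (L * ENNReal.ofReal δ + ENNReal.ofReal δ))
        (nhdsWithin 0 (Ioi 0)) (nhds 0) := by
      have h0 : Tendsto (fun δ : ℝ => ENNReal.ofReal δ) (nhdsWithin 0 (Ioi 0)) (nhds 0) := by
        have := (ENNReal.continuous_ofReal.tendsto 0).mono_left (nhdsWithin_le_nhds (s := Ioi 0))
        simpa using this
      have h1 := ENNReal.Tendsto.const_mul (a := 4)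
        ((ENNReal.Tendsto.const_mul (a := (L : ENNReal)) h0 (Or.inr (by simp))).add h0)
        (Or.inr (by simp))
      simpa using h1
    obtain ⟨δ, hδ1, hδ2⟩ := ((hlim.eventually (gt_mem_nhds hε)).and self_mem_nhdsWithin).exists
    obtain ⟨N, hN⟩ := key δ hδ2
    refine ⟨N, fun k hk l hl => ?_⟩
    rw [Integrable.edist_toL1_toL1]
    exact (hN k hk l hl).trans_lt hδ1
  obtain ⟨v, hv⟩ := cauchySeq_tendsto_of_complete hcau
  obtain ⟨ms, hms, hae⟩ := (tendstoInMeasure_of_tendsto_Lp hv).exists_seq_tendsto_ae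
  refine ⟨ns ∘ ms, v, hns.comp hms, ?_⟩
  have hall : ∀ᵐ x, ∀ k, (hwi (ns k)).toL1 (w (ns k)) x = w (ns k) x :=
    ae_all_iff.2 fun k => (hwi (ns k)).coeFn_toL1
  filter_upwards [hae, hall] with x hx hx2
  refine hx.congr fun k => ?_
  exact hx2 _

lemma smooth_est (U F : E2 → ℝ) (φ : ℝ → ℝ) (hφ : Continuous φ) (hφ0 : ∀ t, 0 ≤ φ t)
    (hU : ContDiff ℝ 1 U) (hF : Continuous F)
    (hUF : ∀ x i, φ (U x) * |fderiv ℝ U x (EuclideanSpace.single i 1)| ≤ φ (U x) * F x)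
    (h : E2) :
    ∫⁻ x, ‖(∫ s in (0:ℝ)..(U (x + h)), φ s) - ∫ s in (0:ℝ)..(U x), φ s‖ₑ ≤
      2 * ‖h‖ₑ * ∫⁻ x, ENNReal.ofReal (φ (U x) * F x) := by
  have hUd : ∀ x, HasFDerivAt U (fderiv ℝ U x) x :=
    fun x => (hU.differentiable (by norm_num) x).hasFDerivAt
  have hcont : Continuous fun y : E2 => φ (U y) * fderiv ℝ U y h :=
    (hφ.comp hU.continuous).mul ((hU.continuous_fderiv (by norm_num)).clm_apply continuous_const)
  have hb : ∀ y, ‖φ (U y) * fderiv ℝ U y h‖ₑ ≤ 2 * ‖h‖ₑ * ENNReal.ofReal (φ (U y) * F y) := by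
    intro y
    have hdec : h = h 0 • EuclideanSpace.single (0 : Fin 2) (1:ℝ) +
        h 1 • EuclideanSpace.single (1 : Fin 2) (1:ℝ) := by
      ext i; fin_cases i <;> simp
    have e1 : fderiv ℝ U y h = h 0 * fderiv ℝ U y (EuclideanSpace.single 0 1) +
        h 1 * fderiv ℝ U y (EuclideanSpace.single 1 1) := by
      conv_lhs => rw [hdec]
      simp
    have h0 := hUF y 0
    have h1 := hUF y 1
    have n0 : |h 0| ≤ ‖h‖ := by simpa using PiLp.norm_apply_le h 0
    have n1 : |h 1| ≤ ‖h‖ := by simpa using PiLp.norm_apply_le h 1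
    have hnn := hφ0 (U y)
    have : ‖φ (U y) * fderiv ℝ U y h‖ ≤ 2 * ‖h‖ * (φ (U y) * F y) := by
      rw [norm_mul, Real.norm_eq_abs, Real.norm_eq_abs, abs_of_nonneg hnn, e1]
      calc _ ≤ φ (U y) * (|h 0| * |fderiv ℝ U y (EuclideanSpace.single 0 1)| +
            |h 1| * |fderiv ℝ U y (EuclideanSpace.single 1 1)|) := by
            gcongr
            refine (abs_add_le _ _).trans ?_
            rw [abs_mul, abs_mul]
        _ = |h 0| * (φ (U y) * |fderiv ℝ U y (EuclideanSpace.single 0 1)|) +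
            |h 1| * (φ (U y) * |fderiv ℝ U y (EuclideanSpace.single 1 1)|) := by ring
        _ ≤ ‖h‖ * (φ (U y) * F y) + ‖h‖ * (φ (U y) * F y) := by gcongr
        _ = _ := by ring
    calc ‖φ (U y) * fderiv ℝ U y h‖ₑ = ENNReal.ofReal ‖φ (U y) * fderiv ℝ U y h‖ :=
          (ofReal_norm _).symm
      _ ≤ ENNReal.ofReal (2 * ‖h‖ * (φ (U y) * F y)) := ENNReal.ofReal_le_ofReal this
      _ = 2 * ‖h‖ₑ * ENNReal.ofReal (φ (U y) * F y) := by
          rw [ENNReal.ofReal_mul (by positivity), ENNReal.ofReal_mul (by norm_num), ofReal_norm]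
          simp
  have hpt : ∀ x, (∫ s in (0:ℝ)..(U (x + h)), φ s) - ∫ s in (0:ℝ)..(U x), φ s =
      ∫ t in (0:ℝ)..1, φ (U (x + t • h)) * fderiv ℝ U (x + t • h) h := by
    intro x
    have hline : Continuous fun t : ℝ => x + t • h := by fun_prop
    rw [intervalIntegral.integral_eq_sub_of_hasDerivAt
      (f := fun t : ℝ => ∫ s in (0:ℝ)..(U (x + t • h)), φ s)
      (f' := fun t : ℝ => φ (U (x + t • h)) * fderiv ℝ U (x + t • h) h)]
    · simp
    · intro t _
      have a1 : HasDerivAt (fun t : ℝ => x + t • h) h t := by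
        simpa using ((hasDerivAt_id t).smul_const h).const_add x
      have a2 := (hUd (x + t • h)).comp_hasDerivAt t a1
      have a3 : HasDerivAt (fun r : ℝ => ∫ s in (0:ℝ)..r, φ s) (φ (U (x + t • h)))
          (U (x + t • h)) :=
        intervalIntegral.integral_hasDerivAt_right (hφ.intervalIntegrable _ _)
          (hφ.stronglyMeasurableAtFilter _ _) hφ.continuousAt
      exact a3.comp t a2
    · exact (hcont.comp hline).intervalIntegrable _ _
  have hGm : Measurable fun y => ENNReal.ofReal (φ (U y) * F y) :=
    (((hφ.comp hU.continuous).mul hF).measurable).ennreal_ofReal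
  calc _ ≤ ∫⁻ x, ∫⁻ t in Ioc (0:ℝ) 1,
        2 * ‖h‖ₑ * ENNReal.ofReal (φ (U (x + t • h)) * F (x + t • h)) := by
        apply lintegral_mono
        intro x
        simp only [hpt x]
        rw [intervalIntegral.integral_of_le zero_le_one]
        refine (enorm_integral_le_lintegral_enorm _).trans ?_
        exact lintegral_mono fun t => hb _
    _ = ∫⁻ t in Ioc (0:ℝ) 1, ∫⁻ x,
        2 * ‖h‖ₑ * ENNReal.ofReal (φ (U (x + t • h)) * F (x + t • h)) := by
        apply lintegral_lintegral_swap
        apply Measurable.aemeasurable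
        have : Measurable fun q : E2 × ℝ => q.1 + q.2 • h := by fun_prop
        exact (hGm.comp this).const_mul _
    _ = ∫⁻ t in Ioc (0:ℝ) 1, 2 * ‖h‖ₑ * ∫⁻ x, ENNReal.ofReal (φ (U x) * F x) := by
        congr 1
        ext t
        rw [lintegral_const_mul]
        · rw [lintegral_add_right_eq_self (fun x => ENNReal.ofReal (φ (U x) * F x)) (t • h)]
        · exact hGm.comp (measurable_id.add_const _)
    _ = _ := by simp

open scoped Convolution in
lemma mollify (u : E2 → ℝ) (g : E2 → E2) (R : ℝ)
    (hu01 : ∀ x, u x ∈ Icc (0:ℝ) 1) (huR : ∀ x, x ∉ ball (0:E2) R → u x = 0)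
    (hui : Integrable u)
    (hw : ∀ i : Fin 2, IsWeakPartialDeriv i u fun x => g x i)
    (f : E2 → ℝ) (hf : f = (ball (0:E2) (R+2)).indicator (fun x => ‖g x‖)) (hfi : Integrable f)
    (b : ContDiffBump (0:E2)) (hb : b.rOut ≤ 1)
    (U F : E2 → ℝ) (hU : U = (b.normed volume ⋆[ContinuousLinearMap.lsmul ℝ ℝ, volume] u))
    (hF : F = (b.normed volume ⋆[ContinuousLinearMap.lsmul ℝ ℝ, volume] f)) :
    ContDiff ℝ 1 U ∧ Continuous F ∧ (∀ x, U x ∈ Icc (0:ℝ) 1) ∧ (∀ x, 0 ≤ F x) ∧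
    (∀ x, U x ≠ 0 → ∀ i, |fderiv ℝ U x (EuclideanSpace.single i 1)| ≤ F x) ∧
    ∫⁻ x, ENNReal.ofReal (F x) = ∫⁻ x, ENNReal.ofReal (f x) := by
  set ρ : E2 → ℝ := b.normed volume with hρ
  have hρc : HasCompactSupport ρ := b.hasCompactSupport_normed
  have hρs : ∀ n : ℕ∞, ContDiff ℝ n ρ := fun n => b.contDiff_normed
  have hρ0 : ∀ x, 0 ≤ ρ x := b.nonneg_normed
  have hρi : Integrable ρ := b.integrable_normed
  have hρ1 : ∫ x, ρ x = 1 := b.integral_normed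
  have hρsupp : ∀ x, ρ x ≠ 0 → ‖x‖ < 1 := by
    intro x hx
    have : x ∈ Function.support ρ := hx
    rw [hρ, b.support_normed_eq, mem_ball_zero_iff] at this
    linarith
  have hf0 : ∀ x, 0 ≤ f x := by
    intro x; rw [hf]; exact indicator_nonneg (fun _ _ => norm_nonneg _) x
  have hUx : ∀ x, U x = ∫ t, u t * ρ (x - t) := by
    intro x
    rw [hU, convolution_eq_swap]
    simp [mul_comm]
  have hFx : ∀ x, F x = ∫ t, f t * ρ (x - t) := by
    intro x
    rw [hF, convolution_eq_swap]
    simp [mul_comm]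
  have hρx : ∀ x, Integrable fun t => ρ (x - t) := fun x => hρi.comp_sub_left x
  have hFint : ∀ x, Integrable fun t => f t * ρ (x - t) := by
    intro x
    have := hρc.convolutionExists_right (ContinuousLinearMap.mul ℝ ℝ) hfi.locallyIntegrable
      (hρs 0).continuous x
    simpa [ConvolutionExistsAt] using this
  have hF0 : ∀ x, 0 ≤ F x := by
    intro x
    rw [hFx]
    exact integral_nonneg fun t => mul_nonneg (hf0 t) (hρ0 _)
  refine ⟨?_, ?_, ?_, hF0, ?_, ?_⟩
  · rw [hU]
    exact hρc.contDiff_convolution_left _ (hρs 1) hui.locallyIntegrable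
  · rw [hF]
    exact hρc.continuous_convolution_left _ (hρs 0).continuous hfi.locallyIntegrable
  · intro x
    rw [hUx]
    constructor
    · exact integral_nonneg fun t => mul_nonneg (hu01 t).1 (hρ0 _)
    · have h1 : ∫ t, ρ (x - t) = 1 := by rw [integral_sub_left_eq_self]; exact hρ1
      rw [← h1]
      apply integral_mono_of_nonneg
      · exact Eventually.of_forall fun t => mul_nonneg (hu01 t).1 (hρ0 _)
      · exact hρx x
      · exact Eventually.of_forall fun t => mul_le_of_le_one_left (hρ0 _) (hu01 t).2
  · intro x hx i
    have hxR : ‖x‖ < R + 1 := by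
      by_contra hcon
      apply hx
      rw [hUx]
      apply integral_eq_zero_of_ae
      refine Eventually.of_forall fun t => ?_
      by_cases ht : ρ (x - t) = 0
      · simp [ht]
      · have h1 := hρsupp _ ht
        have : t ∉ ball (0:E2) R := by
          rw [mem_ball_zero_iff]
          have := norm_sub_norm_le x t
          linarith
        simp [huR t this]
    have hder : fderiv ℝ U x (EuclideanSpace.single i 1) =
        ∫ t, u t * fderiv ℝ ρ (x - t) (EuclideanSpace.single i 1) := by
      have hU' : U = (u ⋆[(ContinuousLinearMap.lsmul ℝ ℝ).flip, volume] ρ) := by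
        rw [hU, convolution_flip]
      have h1 := hρc.hasFDerivAt_convolution_right (ContinuousLinearMap.lsmul ℝ ℝ).flip
        hui.locallyIntegrable (hρs 1) x
      rw [← hU'] at h1
      rw [h1.fderiv, convolution_precompR_apply _ hui.locallyIntegrable (hρc.fderiv ℝ)
        ((hρs 1).continuous_fderiv (by norm_num))]
      simp [convolution_def, mul_comm]
    have hψs : ContDiff ℝ (⊤ : ℕ∞) fun y => ρ (x - y) :=
      (hρs ⊤).comp (contDiff_const.sub contDiff_id)
    have hψc : HasCompactSupport fun y => ρ (x - y) :=
      hρc.comp_homeomorph (Homeomorph.subLeft x)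
    have hψd : ∀ y, fderiv ℝ (fun y => ρ (x - y)) y (EuclideanSpace.single i 1) =
        - fderiv ℝ ρ (x - y) (EuclideanSpace.single i 1) := by
      intro y
      have h1 : HasFDerivAt ρ (fderiv ℝ ρ (x - y)) (x - y) :=
        ((hρs 1).differentiable (by norm_num) _).hasFDerivAt
      have h2 : HasFDerivAt (fun y : E2 => x - y) (-ContinuousLinearMap.id ℝ E2) y :=
        (hasFDerivAt_id y).const_sub x
      have h3 := h1.comp y h2
      have h4 : fderiv ℝ (fun y => ρ (x - y)) y = _ := h3.fderiv
      rw [h4]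
      simp
    have hweak := hw i _ hψs hψc
    simp only [hψd, mul_neg, integral_neg, neg_inj] at hweak
    rw [hder, hweak, hFx, ← Real.norm_eq_abs]
    apply norm_integral_le_of_norm_le (hFint x)
    refine Eventually.of_forall fun t => ?_
    by_cases ht : ρ (x - t) = 0
    · simp [ht]
    · have h1 := hρsupp _ ht
      have : t ∈ ball (0:E2) (R+2) := by
        rw [mem_ball_zero_iff]
        have := norm_sub_norm_le t x
        rw [norm_sub_rev] at this
        linarith
      rw [norm_mul, Real.norm_of_nonneg (hρ0 _), hf, indicator_of_mem this]
      exact mul_le_mul_of_nonneg_right (PiLp.norm_apply_le (g t) i) (hρ0 _)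
  · have hFi : Integrable F := by
      rw [hF]
      exact hρi.integrable_convolution _ hfi
    rw [← ofReal_integral_eq_lintegral_ofReal hFi (Eventually.of_forall hF0),
      ← ofReal_integral_eq_lintegral_ofReal hfi (Eventually.of_forall hf0), hF,
      integral_convolution _ hρi hfi, hρ1]
    simp

lemma transl_est (u : E2 → ℝ) (g : E2 → E2) (R : ℝ) (hum : Measurable u)
    (hu01 : ∀ x, u x ∈ Icc (0:ℝ) 1) (huR : ∀ x, x ∉ ball (0:E2) R → u x = 0)
    (hui : Integrable u)
    (hw : ∀ i : Fin 2, IsWeakPartialDeriv i u fun x => g x i)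
    (hgi : IntegrableOn (fun x => ‖g x‖) (ball (0:E2) (R+2)))
    (φ : ℝ → ℝ) (hφ : Continuous φ) (hφ0 : ∀ t, 0 ≤ φ t) (hφz : φ 0 = 0) (h : E2) :
    ∫⁻ x, ‖(∫ s in (0:ℝ)..(u (x + h)), φ s) - ∫ s in (0:ℝ)..(u x), φ s‖ₑ ≤
      2 * ‖h‖ₑ * ∫⁻ x, ENNReal.ofReal (φ (u x) * ‖g x‖) := by
  set f : E2 → ℝ := (ball (0:E2) (R+2)).indicator (fun x => ‖g x‖) with hf
  have hfi : Integrable f := (integrable_indicator_iff measurableSet_ball).2 hgi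
  have hf0 : ∀ x, 0 ≤ f x := by
    intro x; rw [hf]; exact indicator_nonneg (fun _ _ => norm_nonneg _) x
  have hfg : ∀ x, φ (u x) * ‖g x‖ = φ (u x) * f x := by
    intro x
    by_cases hx : x ∈ ball (0:E2) R
    · have : x ∈ ball (0:E2) (R+2) := ball_subset_ball (by linarith) hx
      rw [hf, indicator_of_mem this]
    · rw [huR x hx, hφz]; simp
  simp only [hfg]
  obtain ⟨M, hM⟩ : ∃ M, ∀ t ∈ Icc (0:ℝ) 1, φ t ≤ M := by
    obtain ⟨M, hM⟩ := (isCompact_Icc (a := (0:ℝ)) (b := 1)).bddAbove_image hφ.continuousOn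
    exact ⟨M, fun t ht => hM (mem_image_of_mem _ ht)⟩
  let b : ℕ → ContDiffBump (0:E2) := fun n =>
    { rIn := 1 / (2 * ((n:ℝ) + 1))
      rOut := 1 / ((n:ℝ) + 1)
      rIn_pos := by positivity
      rIn_lt_rOut := by
        apply one_div_lt_one_div_of_lt
        · positivity
        · have : (0:ℝ) ≤ n := n.cast_nonneg
          linarith }
  have hb1 : ∀ n, (b n).rOut ≤ 1 := by
    intro n
    change 1 / ((n:ℝ) + 1) ≤ 1
    rw [div_le_one (by positivity)]
    have : (0:ℝ) ≤ n := n.cast_nonneg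
    linarith
  have hblim : Tendsto (fun n => (b n).rOut) atTop (nhds 0) :=
    tendsto_one_div_add_atTop_nhds_zero_nat
  have hbK : ∀ᶠ n in atTop, (b n).rOut ≤ 2 * (b n).rIn := by
    refine Eventually.of_forall fun n => ?_
    change 1 / ((n:ℝ) + 1) ≤ 2 * (1 / (2 * ((n:ℝ) + 1)))
    apply le_of_eq
    field_simp
  let U : ℕ → E2 → ℝ := fun n =>
    convolution ((b n).normed volume) u (ContinuousLinearMap.lsmul ℝ ℝ) volume
  let F : ℕ → E2 → ℝ := fun n =>
    convolution ((b n).normed volume) f (ContinuousLinearMap.lsmul ℝ ℝ) volume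
  have hUlim : ∀ᵐ x, Tendsto (fun n => U n x) atTop (nhds (u x)) :=
    ContDiffBump.ae_convolution_tendsto_right_of_locallyIntegrable hblim hbK hui.locallyIntegrable
  have hFlim : ∀ᵐ x, Tendsto (fun n => F n x) atTop (nhds (f x)) :=
    ContDiffBump.ae_convolution_tendsto_right_of_locallyIntegrable hblim hbK hfi.locallyIntegrable
  have hmol := fun n => mollify u g R hu01 huR hui hw f hf hfi (b n) (hb1 n) (U n) (F n) rfl rfl
  let Φ : ℝ → ℝ := fun t => ∫ s in (0:ℝ)..t, φ s
  have hΦ : Continuous Φ := intervalIntegral.continuous_primitive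
    (fun a b => hφ.intervalIntegrable a b) 0
  have hUlim' : ∀ᵐ x, Tendsto (fun n => U n (x + h)) atTop (nhds (u (x + h))) :=
    (measurePreserving_add_right volume h).quasiMeasurePreserving.ae hUlim
  set c : ENNReal := 2 * ‖h‖ₑ with hc
  have hct : c ≠ ⊤ := ENNReal.mul_ne_top (by simp) (by simp)
  -- the combined integrand
  let G : ℕ → E2 → ENNReal := fun n x =>
    ‖Φ (U n (x + h)) - Φ (U n x)‖ₑ + c * ENNReal.ofReal ((M - φ (U n x)) * F n x)
  have hUc : ∀ n, Continuous (U n) := fun n => (hmol n).1.continuous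
  have hm1 : ∀ n, Measurable fun x => ENNReal.ofReal ((M - φ (U n x)) * F n x) := fun n =>
    ((continuous_const.sub (hφ.comp (hUc n))).mul (hmol n).2.1).measurable.ennreal_ofReal
  have hm2 : ∀ n, Measurable fun x => ENNReal.ofReal (φ (U n x) * F n x) := fun n =>
    ((hφ.comp (hUc n)).mul (hmol n).2.1).measurable.ennreal_ofReal
  have hm3 : ∀ n, Measurable fun x => ‖Φ (U n (x + h)) - Φ (U n x)‖ₑ := fun n =>
    ((hΦ.comp ((hUc n).comp (continuous_id.add continuous_const))).sub
      (hΦ.comp (hUc n))).measurable.enorm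
  have hGm : ∀ n, Measurable (G n) := fun n => (hm3 n).add ((hm1 n).const_mul c)
  have hsplit : ∀ t ∈ Icc (0:ℝ) 1, ∀ y : ℝ, 0 ≤ y →
      ENNReal.ofReal (φ t * y) + ENNReal.ofReal ((M - φ t) * y) =
        ENNReal.ofReal M * ENNReal.ofReal y := by
    intro t ht y hy
    have := hM t ht
    have h0 := hφ0 t
    rw [← ENNReal.ofReal_add (mul_nonneg h0 hy) (mul_nonneg (by linarith) hy),
      ← ENNReal.ofReal_mul (by linarith)]
    congr 1; ring
  have hGle : ∀ n, ∫⁻ x, G n x ≤ c * (ENNReal.ofReal M * ∫⁻ x, ENNReal.ofReal (f x)) := by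
    intro n
    obtain ⟨p1, p2, p3, p4, p5, p6⟩ := hmol n
    have hs := smooth_est (U n) (F n) φ hφ hφ0 p1 p2 (by
      intro x i
      by_cases hx : U n x = 0
      · rw [hx, hφz]; simp
      · exact mul_le_mul_of_nonneg_left (p5 x hx i) (hφ0 _)) h
    calc ∫⁻ x, G n x = (∫⁻ x, ‖Φ (U n (x + h)) - Φ (U n x)‖ₑ) +
          c * ∫⁻ x, ENNReal.ofReal ((M - φ (U n x)) * F n x) := by
          rw [lintegral_add_left (hm3 n), lintegral_const_mul _ (hm1 n)]
      _ ≤ c * (∫⁻ x, ENNReal.ofReal (φ (U n x) * F n x)) +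
          c * ∫⁻ x, ENNReal.ofReal ((M - φ (U n x)) * F n x) := by gcongr
      _ = c * ∫⁻ x, (ENNReal.ofReal (φ (U n x) * F n x) +
            ENNReal.ofReal ((M - φ (U n x)) * F n x)) := by
          rw [lintegral_add_left (hm2 n), mul_add]
      _ = c * ∫⁻ x, ENNReal.ofReal M * ENNReal.ofReal (F n x) := by
          simp only [fun x => hsplit _ (p3 x) _ (p4 x)]
      _ = _ := by
          rw [lintegral_const_mul _ p2.measurable.ennreal_ofReal, p6]
  have hfatou : (∫⁻ x, (‖Φ (u (x + h)) - Φ (u x)‖ₑ + c * ENNReal.ofReal ((M - φ (u x)) * f x))) ≤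
      c * (ENNReal.ofReal M * ∫⁻ x, ENNReal.ofReal (f x)) := by
    calc _ = ∫⁻ x, liminf (fun n => G n x) atTop := by
          apply lintegral_congr_ae
          filter_upwards [hUlim, hUlim', hFlim] with x h1 h2 h3
          symm
          apply Tendsto.liminf_eq
          apply Tendsto.add
          · exact (((hΦ.tendsto _).comp h2).sub ((hΦ.tendsto _).comp h1)).enorm
          · apply ENNReal.Tendsto.const_mul _ (Or.inr hct)
            exact ENNReal.tendsto_ofReal
              ((tendsto_const_nhds.sub ((hφ.tendsto _).comp h1)).mul h3)
      _ ≤ liminf (fun n => ∫⁻ x, G n x) atTop := lintegral_liminf_le hGm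
      _ ≤ _ := by
          refine (liminf_le_liminf (Eventually.of_forall hGle)).trans ?_
          simp
  have hfm : AEMeasurable f := hfi.1.aemeasurable
  have hφum : Measurable fun x => φ (u x) := hφ.measurable.comp hum
  have am1 : AEMeasurable fun x => ENNReal.ofReal ((M - φ (u x)) * f x) :=
    ((hφum.const_sub M).aemeasurable.mul hfm).ennreal_ofReal
  have am2 : AEMeasurable fun x => ENNReal.ofReal (φ (u x) * f x) :=
    (hφum.aemeasurable.mul hfm).ennreal_ofReal
  have hrhs : c * (ENNReal.ofReal M * ∫⁻ x, ENNReal.ofReal (f x)) =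
      c * (∫⁻ x, ENNReal.ofReal (φ (u x) * f x)) +
        c * ∫⁻ x, ENNReal.ofReal ((M - φ (u x)) * f x) := by
    rw [← mul_add, ← lintegral_add_left' am2, ← lintegral_const_mul'' _ hfm.ennreal_ofReal]
    simp only [fun x => hsplit _ (hu01 x) _ (hf0 x)]
  have hfin : c * ∫⁻ x, ENNReal.ofReal ((M - φ (u x)) * f x) ≠ ⊤ := by
    apply ENNReal.mul_ne_top hct
    have hfl : ENNReal.ofReal M * ∫⁻ x, ENNReal.ofReal (f x) ≠ ⊤ := by
      apply ENNReal.mul_ne_top ENNReal.ofReal_ne_top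
      rw [← ofReal_integral_eq_lintegral_ofReal hfi (Eventually.of_forall hf0)]
      exact ENNReal.ofReal_ne_top
    refine ne_top_of_le_ne_top hfl ?_
    rw [← lintegral_const_mul'' _ hfm.ennreal_ofReal]
    apply lintegral_mono
    intro x
    simp only [← hsplit _ (hu01 x) _ (hf0 x)]
    exact le_add_self
  rw [hrhs, lintegral_add_right' _ (am1.const_mul c), lintegral_const_mul'' _ am1] at hfatou
  exact (ENNReal.add_le_add_iff_right hfin).1 hfatou

lemma energy_est (D : Set E2) (hDf : volume D ≠ ⊤)
    (p : ℝ) (hp : 1 < p)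
    (W : ℝ → ℝ) (hWc : Continuous W) (hWnn : ∀ t, 0 ≤ W t)
    (hWz : ∀ t, W t = 0 ↔ t = 0 ∨ t = 1) (C I ε : ℝ) (hI : 0 < I) (hε : 0 < ε)
    (u : E2 → ℝ) (g : E2 → E2) (hum : Measurable u) (hu01 : ∀ x, u x ∈ Icc (0:ℝ) 1)
    (huD : ∀ x, x ∉ D → u x = 0) (hgp : Integrable (fun x => ‖g x‖ ^ p))
    (hP : (I⁻¹ / (p / (p - 1) * ε)) * (∫ x in D, W (u x)) +
          (I⁻¹ * ε ^ (p - 1) / p) * (∫ x in D, ‖g x‖ ^ p) ≤ C) :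
    ∫⁻ x, ENNReal.ofReal (W (u x) ^ ((p - 1) / p) * ‖g x‖) ≤ ENNReal.ofReal (C * I) := by
  have hp0 : 0 < p := by linarith
  have hp1 : 0 < p - 1 := by linarith
  have hconj : (p / (p - 1)).HolderConjugate p := (Real.HolderConjugate.conjExponent hp).symm
  have hWi : IntegrableOn (fun x => W (u x)) D := by
    obtain ⟨M, hM⟩ := (isCompact_Icc (a := (0:ℝ)) (b := 1)).bddAbove_image hWc.continuousOn
    refine Integrable.mono' (g := fun _ => M) (integrableOn_const hDf)
      (hWc.measurable.comp hum).aestronglyMeasurable (Eventually.of_forall fun x => ?_)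
    rw [Real.norm_of_nonneg (hWnn _)]
    exact hM (mem_image_of_mem _ (hu01 x))
  set A : ℝ := 1 / (p / (p - 1) * ε) with hA
  set B : ℝ := ε ^ (p - 1) / p with hB
  have hA0 : 0 ≤ A := by positivity
  have hB0 : 0 ≤ B := by positivity
  have hyoung : ∀ x, W (u x) ^ ((p - 1) / p) * ‖g x‖ ≤ A * W (u x) + B * ‖g x‖ ^ p := by
    intro x
    have hw := hWnn (u x)
    have hn := norm_nonneg (g x)
    set s : ℝ := ε ^ ((p - 1) / p) with hs
    have hs0 : 0 < s := Real.rpow_pos_of_pos hε _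
    have hY := Real.young_inequality_of_nonneg (a := W (u x) ^ ((p - 1) / p) / s)
      (b := s * ‖g x‖) (by positivity) (by positivity) hconj
    have e1 : (W (u x) ^ ((p - 1) / p) / s) ^ (p / (p - 1)) = W (u x) / ε := by
      rw [Real.div_rpow (by positivity) hs0.le, hs, ← Real.rpow_mul hw, ← Real.rpow_mul hε.le]
      have : (p - 1) / p * (p / (p - 1)) = 1 := by field_simp
      rw [this, Real.rpow_one, Real.rpow_one]
    have e2 : (s * ‖g x‖) ^ p = ε ^ (p - 1) * ‖g x‖ ^ p := by
      rw [Real.mul_rpow hs0.le hn, hs, ← Real.rpow_mul hε.le]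
      congr 2; field_simp
    rw [e1, e2] at hY
    have e3 : W (u x) ^ ((p - 1) / p) / s * (s * ‖g x‖) = W (u x) ^ ((p - 1) / p) * ‖g x‖ := by
      field_simp
    rw [e3] at hY
    refine hY.trans (le_of_eq ?_)
    rw [hA, hB]
    field_simp
  have hz : ∀ x, x ∉ D → ENNReal.ofReal (W (u x) ^ ((p - 1) / p) * ‖g x‖) = 0 := by
    intro x hx
    rw [huD x hx, (hWz 0).2 (Or.inl rfl), Real.zero_rpow (by positivity)]
    simp
  have hint : IntegrableOn (fun x => A * W (u x) + B * ‖g x‖ ^ p) D :=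
    (hWi.const_mul A).add (hgp.integrableOn.const_mul B)
  calc ∫⁻ x, ENNReal.ofReal (W (u x) ^ ((p - 1) / p) * ‖g x‖)
      = ∫⁻ x in D, ENNReal.ofReal (W (u x) ^ ((p - 1) / p) * ‖g x‖) := by
        symm
        apply setLIntegral_eq_of_support_subset
        intro x hx
        by_contra hc
        exact hx (hz x hc)
    _ ≤ ∫⁻ x in D, ENNReal.ofReal (A * W (u x) + B * ‖g x‖ ^ p) :=
        lintegral_mono fun x => ENNReal.ofReal_le_ofReal (hyoung x)
    _ = ENNReal.ofReal (∫ x in D, (A * W (u x) + B * ‖g x‖ ^ p)) := by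
        rw [ofReal_integral_eq_lintegral_ofReal hint]
        refine Eventually.of_forall fun x => ?_
        have := hWnn (u x)
        change 0 ≤ A * W (u x) + B * ‖g x‖ ^ p
        positivity
    _ ≤ ENNReal.ofReal (C * I) := by
        apply ENNReal.ofReal_le_ofReal
        rw [integral_add (hWi.const_mul A) (hgp.integrableOn.const_mul B), integral_const_mul,
          integral_const_mul]
        have := mul_le_mul_of_nonneg_right hP hI.le
        refine le_trans (le_of_eq ?_) this
        rw [hA, hB]
        field_simp

/-- Equicoercivity of the Modica–Mortola functionals: a family `{u_ε}` in `W^{1,p}₀(D)`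
(encoded as functions on `ℝ²` vanishing a.e. outside `D`, with integrable weak gradient `g ε`),
with `0 ≤ u_ε ≤ 1` a.e. and `P_ε(u_ε) ≤ C`, is precompact in `L¹`:
every sequence `ε_n → 0⁺` has a subsequence along which `u_{ε_n}` converges in `L¹`. -/
theorem stmt2 (D : Set E2) (hDo : IsOpen D) (hDb : Bornology.IsBounded D)
    (p : ℝ) (hp : 1 < p)
    (W : ℝ → ℝ) (hWc : Continuous W) (hWnn : ∀ t, 0 ≤ W t)
    (hWz : ∀ t, W t = 0 ↔ t = 0 ∨ t = 1)
    (C ε₀ : ℝ) (hC : 0 < C) (hε₀ : 0 < ε₀)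
    (u : ℝ → E2 → ℝ) (g : ℝ → E2 → E2)
    (hmem : ∀ ε ∈ Ioc (0 : ℝ) ε₀,
      Measurable (u ε) ∧
      (∀ᵐ x, x ∉ D → u ε x = 0) ∧
      (∀ᵐ x, u ε x ∈ Icc (0 : ℝ) 1) ∧
      (∀ i : Fin 2, IsWeakPartialDeriv i (u ε) fun x => g ε x i) ∧
      Integrable (u ε) ∧ Integrable (fun x => ‖g ε x‖ ^ p))
    (hP : ∀ ε ∈ Ioc (0 : ℝ) ε₀,
      ((∫ s in (0 : ℝ)..1, W s ^ ((p - 1) / p))⁻¹ / (p / (p - 1) * ε)) *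
            (∫ x in D, W (u ε x)) +
          ((∫ s in (0 : ℝ)..1, W s ^ ((p - 1) / p))⁻¹ * ε ^ (p - 1) / p) *
            (∫ x in D, ‖g ε x‖ ^ p) ≤ C)
    (εseq : ℕ → ℝ) (hεseq : ∀ n, εseq n ∈ Ioc (0 : ℝ) ε₀)
    (hεlim : Tendsto εseq atTop (nhds 0)) :
    ∃ (ns : ℕ → ℕ) (v : E2 → ℝ), StrictMono ns ∧ Integrable v ∧
      Tendsto (fun k => ∫ x, |u (εseq (ns k)) x - v x|) atTop (nhds 0) := by
  classical
  obtain ⟨R, hR⟩ := hDb.subset_ball (0:E2)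
  have hp0 : 0 < p := by linarith
  have hp1 : 0 < p - 1 := by linarith
  have hDf : volume D ≠ ⊤ := hDb.measure_lt_top.ne
  -- modified representatives
  let ut : ℕ → E2 → ℝ := fun n x =>
    if x ∈ D ∧ u (εseq n) x ∈ Icc (0:ℝ) 1 then u (εseq n) x else 0
  have hutm : ∀ n, Measurable (ut n) := by
    intro n
    have hm := (hmem _ (hεseq n)).1
    exact Measurable.ite (hDo.measurableSet.inter (hm measurableSet_Icc)) hm measurable_const
  have hut01 : ∀ n x, ut n x ∈ Icc (0:ℝ) 1 := by
    intro n x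
    simp only [ut]
    split_ifs with h
    · exact h.2
    · simp
  have hutD : ∀ n x, x ∉ D → ut n x = 0 := by
    intro n x hx
    simp [ut, hx]
  have hae : ∀ n, ut n =ᵐ[volume] u (εseq n) := by
    intro n
    obtain ⟨-, h1, h2, -⟩ := hmem _ (hεseq n)
    filter_upwards [h1, h2] with x hx1 hx2
    by_cases hx : x ∈ D
    · simp only [ut]
      rw [if_pos ⟨hx, hx2⟩]
    · rw [hutD n x hx, hx1 hx]
  -- the primitive
  set φ : ℝ → ℝ := fun s => W s ^ ((p - 1) / p) with hφdef
  have hφ : Continuous φ := hWc.rpow_const fun x => Or.inr (by positivity)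
  have hφ0 : ∀ t, 0 ≤ φ t := fun t => Real.rpow_nonneg (hWnn t) _
  have hφz : φ 0 = 0 := by
    simp only [hφdef]
    rw [(hWz 0).2 (Or.inl rfl), Real.zero_rpow (by positivity)]
  let Φ : ℝ → ℝ := fun t => ∫ s in (0:ℝ)..t, φ s
  have hΦc : Continuous Φ := intervalIntegral.continuous_primitive
    (fun a b => hφ.intervalIntegrable a b) 0
  have hΦm : StrictMono Φ := by
    intro a b hab
    have h1 : 0 < ∫ s in a..b, φ s := by
      apply intervalIntegral.integral_pos hab hφ.continuousOn (fun x _ => hφ0 x)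
      obtain ⟨c, hc, hc2⟩ := (Ioo_infinite hab).exists_notMem_finset ({0, 1} : Finset ℝ)
      refine ⟨c, Ioo_subset_Icc_self hc, ?_⟩
      apply Real.rpow_pos_of_pos
      refine lt_of_le_of_ne (hWnn c) fun h => hc2 ?_
      simpa using (hWz c).1 h.symm
    have h2 : (∫ s in (0:ℝ)..a, φ s) + ∫ s in a..b, φ s = ∫ s in (0:ℝ)..b, φ s :=
      intervalIntegral.integral_add_adjacent_intervals (hφ.intervalIntegrable _ _)
        (hφ.intervalIntegrable _ _)
    change (∫ s in (0:ℝ)..a, φ s) < ∫ s in (0:ℝ)..b, φ s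
    linarith
  have hΦ0 : Φ 0 = 0 := by simp [Φ]
  set I : ℝ := ∫ s in (0:ℝ)..1, φ s with hI
  have hI1 : Φ 1 = I := rfl
  have hIpos : 0 < I := by
    rw [← hI1, ← hΦ0]; exact hΦm one_pos
  have htrans : ∀ n h, ∫⁻ x, ‖Φ (ut n (x + h)) - Φ (ut n x)‖ₑ ≤
      ((2 * (C * I)).toNNReal : NNReal) * ‖h‖ₑ := by
    intro n h
    obtain ⟨-, -, -, hwk, hui, hgp⟩ := hmem _ (hεseq n)
    have hεn := hεseq n
    have hgm : AEStronglyMeasurable (fun x => ‖g (εseq n) x‖) volume := by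
      have h1 : AEMeasurable (fun x => (‖g (εseq n) x‖ ^ p) ^ p⁻¹) volume :=
        hgp.1.aemeasurable.pow_const _
      have h2 : (fun x => (‖g (εseq n) x‖ ^ p) ^ p⁻¹) = fun x => ‖g (εseq n) x‖ := by
        ext x
        exact Real.rpow_rpow_inv (norm_nonneg _) hp0.ne'
      rw [h2] at h1
      exact h1.aestronglyMeasurable
    have hgi : IntegrableOn (fun x => ‖g (εseq n) x‖) (ball (0:E2) (R + 2)) := by
      refine Integrable.mono' (g := fun x => 1 + ‖g (εseq n) x‖ ^ p)
        ((integrableOn_const measure_ball_lt_top.ne).add hgp.integrableOn) hgm.restrict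
        (Eventually.of_forall fun x => ?_)
      rw [norm_norm]
      have hn := norm_nonneg (g (εseq n) x)
      rcases le_total ‖g (εseq n) x‖ 1 with h1 | h1
      · have := Real.rpow_nonneg hn p
        linarith
      · have := Real.self_le_rpow_of_one_le h1 hp.le
        linarith
    have hwk' : ∀ i : Fin 2, IsWeakPartialDeriv i (ut n) fun x => g (εseq n) x i := by
      intro i ψ h1 h2
      rw [← hwk i ψ h1 h2]
      apply integral_congr_ae
      filter_upwards [hae n] with x hx
      rw [hx]
    have h1 := transl_est (ut n) (g (εseq n)) R (hutm n) (hut01 n)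
      (fun x hx => hutD n x fun hxD => hx (hR hxD)) (hui.congr (hae n).symm) hwk' hgi φ hφ hφ0 hφz h
    have hPn := hP _ hεn
    have hWeq : ∫ x in D, W (u (εseq n) x) = ∫ x in D, W (ut n x) := by
      apply integral_congr_ae
      filter_upwards [ae_restrict_of_ae (hae n)] with x hx
      rw [hx]
    rw [hWeq] at hPn
    have h2 := energy_est D hDf p hp W hWc hWnn hWz C I (εseq n) hIpos hεn.1
      (ut n) (g (εseq n)) (hutm n) (hut01 n) (hutD n) hgp hPn
    refine h1.trans ?_
    calc 2 * ‖h‖ₑ * ∫⁻ x, ENNReal.ofReal (φ (ut n x) * ‖g (εseq n) x‖)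
        ≤ 2 * ‖h‖ₑ * ENNReal.ofReal (C * I) := by gcongr
      _ = ENNReal.ofReal (2 * (C * I)) * ‖h‖ₑ := by
        rw [ENNReal.ofReal_mul (by norm_num : (0:ℝ) ≤ 2)]
        simp only [ENNReal.ofReal_ofNat]
        ring
  obtain ⟨ns, v, hns, hv⟩ := l1_compact (fun n x => Φ (ut n x)) I R (2 * (C * I)).toNNReal
    (fun n => hΦc.measurable.comp (hutm n))
    (by
      intro n x
      have h1 : Φ 0 ≤ Φ (ut n x) := hΦm.monotone (hut01 n x).1
      have h2 : Φ (ut n x) ≤ Φ 1 := hΦm.monotone (hut01 n x).2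
      rw [abs_of_nonneg (by rw [← hΦ0]; exact h1)]
      exact h2)
    (by
      intro n x hx
      change Φ (ut n x) = 0
      rw [hutD n x fun hxD => hx (hR hxD), hΦ0]) htrans
  have hemb : Topology.IsEmbedding Φ :=
    hΦm.isEmbedding_of_ordConnected (isPreconnected_range hΦc).ordConnected
  have hex : ∀ᵐ x, ∃ l, Tendsto (fun k => ut (ns k) x) atTop (nhds l) := by
    filter_upwards [hv] with x hx
    have hcl : v x ∈ Icc (Φ 0) (Φ 1) := isClosed_Icc.mem_of_tendsto hx
      (Eventually.of_forall fun k =>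
        ⟨hΦm.monotone (hut01 _ x).1, hΦm.monotone (hut01 _ x).2⟩)
    obtain ⟨s, -, hs⟩ := intermediate_value_Icc (zero_le_one (α := ℝ)) hΦc.continuousOn hcl
    refine ⟨s, hemb.tendsto_nhds_iff.2 ?_⟩
    rw [hs]
    exact hx
  obtain ⟨z, hzm, hz⟩ := measurable_limit_of_tendsto_metrizable_ae
    (fun k => (hutm (ns k)).aemeasurable) hex
  have hball : Integrable (D.indicator fun _ => (1:ℝ)) :=
    (integrable_indicator_iff hDo.measurableSet).2 (integrableOn_const hDf)
  have hutb : ∀ n x, |ut n x| ≤ D.indicator (fun _ => (1:ℝ)) x := by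
    intro n x
    by_cases hx : x ∈ D
    · rw [indicator_of_mem hx, abs_of_nonneg (hut01 n x).1]
      exact (hut01 n x).2
    · rw [indicator_of_notMem hx, hutD n x hx]; simp
  have hzb : ∀ᵐ x, |z x| ≤ D.indicator (fun _ => (1:ℝ)) x := by
    filter_upwards [hz] with x hx
    exact le_of_tendsto' hx.abs fun k => hutb _ x
  refine ⟨ns, z, hns, hball.mono' hzm.aestronglyMeasurable hzb, ?_⟩
  have hlim := tendsto_integral_of_dominated_convergence (μ := (volume : Measure E2))
    (F := fun k x => |ut (ns k) x - z x|) (f := fun _ => (0:ℝ))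
    (fun x => 2 * D.indicator (fun _ => (1:ℝ)) x)
    (fun k => ((hutm (ns k)).sub hzm).abs.aestronglyMeasurable) (hball.const_mul 2)
    (by
      intro k
      filter_upwards [hzb] with x hx
      rw [Real.norm_eq_abs, abs_abs]
      have := abs_sub (ut (ns k) x) (z x)
      have := hutb (ns k) x
      linarith)
    (by
      filter_upwards [hz] with x hx
      simpa using (hx.sub_const (z x)).abs)
  rw [integral_zero] at hlim
  refine hlim.congr fun k => ?_
  apply integral_congr_ae
  filter_upwards [hae (ns k)] with x hx
  rw [hx]
end
end

section
/- Fix positive constants r, L, R. There exist constants c₁ ∈ (0,1] and C ≥ 1, depending on L only, such that for any two bounded open sets Ω₁, Ω₂ ⊂ B_R ⊂ ℝ² which are Lipschitz with constants r and L, denoting d₁ = d_H(Ω̄₁, Ω̄₂) (Hausdorff distance of the closures) and d̃₁ = d_H(∂Ω₁, ∂Ω₂) (Hausdorff distance of the boundaries), the following holds: if either d₁ ≤ c₁ r or d̃₁ ≤ c₁ r, then d₁ ≤ d̃₁ ≤ C d₁. -/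
open MeasureTheory Metric Set

noncomputable section

/-- A bounded open set `Ω ⊆ ℝ²` is Lipschitz with constants `r` and `L`:
at every boundary point, after a rigid change of coordinates taking the point to the origin,
`Ω` coincides in the ball of radius `r` with the subgraph of an `L`-Lipschitz function
vanishing at `0`. -/
def IsLipDomain (r L : ℝ) (Ω : Set E2) : Prop :=
  ∀ x ∈ frontier Ω, ∃ (A : E2 ≃ᵢ E2) (φ : ℝ → ℝ),
    A x = 0 ∧ LipschitzWith (Real.toNNReal L) φ ∧ φ 0 = 0 ∧
    ∀ y ∈ ball x r, (y ∈ Ω ↔ (A y) 1 < φ ((A y) 0))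


section helpers

/-- Local chart data: a height function and vertical translations. -/
structure Chart (r K : ℝ) (Ω : Set E2) (p : E2) (h : E2 → ℝ) (τ : ℝ → E2 → E2) : Prop where
  lip : ∀ y z, h y - h z ≤ K * dist y z
  zero : h p = 0
  move : ∀ s y, dist (τ s y) y = |s|
  iso : ∀ s y z, dist (τ s y) (τ s z) = dist y z
  up : ∀ s y, h (τ s y) = h y + s
  inv : ∀ s y, τ (-s) (τ s y) = y
  cont : ∀ y, Continuous (fun s => τ s y)
  mem : ∀ y, dist y p < r → (y ∈ Ω ↔ h y < 0)

lemma exists_chart {r L : ℝ} (hL : 0 < L) {Ω : Set E2} (H : IsLipDomain r L Ω) {p : E2}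
    (hp : p ∈ frontier Ω) : ∃ h τ, Chart r (1 + L) Ω p h τ := by
  obtain ⟨A, φ, hA, hφ, h0, hm⟩ := H p hp
  let e : E2 := EuclideanSpace.single 1 1
  have he : ‖e‖ = 1 := by simp [e]
  have e0 : e 0 = 0 := by simp [e]
  have e1 : e 1 = 1 := by simp [e]
  refine ⟨fun y => A y 1 - φ (A y 0), fun s y => A.symm (A y + s • e), ?_, ?_, ?_, ?_, ?_, ?_, ?_, ?_⟩
  · intro y z
    have h1 : ∀ i, |A y i - A z i| ≤ dist y z := by
      intro i
      have := PiLp.norm_apply_le (A y - A z) i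
      rw [← dist_eq_norm, A.isometry.dist_eq] at this
      simpa using this
    have h2 := hφ.dist_le_mul (A z 0) (A y 0)
    rw [Real.coe_toNNReal _ hL.le, Real.dist_eq, Real.dist_eq] at h2
    have h3 := h1 0
    rw [abs_sub_comm] at h3
    have h4 := mul_le_mul_of_nonneg_left h3 hL.le
    have h5 := (abs_le.1 (h1 1)).2
    have h6 := (abs_le.1 h2).2
    dsimp only
    linarith
  · simp [hA, h0]
  · intro s y
    rw [← A.isometry.dist_eq]
    simp [dist_eq_norm, norm_smul, he]
  · intro s y z
    simp [A.symm.isometry.dist_eq, A.isometry.dist_eq]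
  · intro s y
    simp [e0, e1]; ring
  · intro s y
    simp
  · intro y
    have := A.symm.continuous
    fun_prop
  · intro y hy
    rw [hm y (mem_ball.2 hy)]
    exact sub_neg.symm

/-- crossing the frontier -/
lemma conn_iff {S T : Set E2} (hS : IsPreconnected S) (hd : ∀ w ∈ S, w ∉ frontier T) {y z : E2}
    (hy : y ∈ S) (hz : z ∈ S) : y ∈ T ↔ z ∈ T := by
  have key : ∀ a ∈ S, ∀ b ∈ S, a ∈ T → b ∈ T := by
    intro a ha b hb haT
    by_contra hbT
    have hA : ∀ w ∈ S, w ∈ T → w ∈ interior T := fun w hw hwT => by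
      by_contra hc
      exact hd w hw ⟨subset_closure hwT, hc⟩
    have hB : ∀ w ∈ S, w ∉ T → w ∈ (closure T)ᶜ := fun w hw hwT hc =>
      hd w hw ⟨hc, fun hi => hwT (interior_subset hi)⟩
    obtain ⟨w, -, hw1, hw2⟩ := hS _ _ isOpen_interior isClosed_closure.isOpen_compl
      (fun w hw => (em (w ∈ T)).imp (hA w hw) (hB w hw)) ⟨a, ha, hA a ha haT⟩ ⟨b, hb, hB b hb hbT⟩
    exact hw2 (subset_closure (interior_subset hw1))
  exact ⟨key y hy z hz, key z hz y hy⟩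

variable {r K : ℝ} {Ω : Set E2} {p : E2} {h : E2 → ℝ} {τ : ℝ → E2 → E2}

lemma Chart.continuous (c : Chart r K Ω p h τ) : Continuous h := by
  have : LipschitzWith (Real.toNNReal K) h := by
    refine LipschitzWith.of_dist_le_mul fun y z => ?_
    have h1 := c.lip y z
    have h2 := c.lip z y
    rw [dist_comm z y] at h2
    have h3 : K * dist y z ≤ Real.toNNReal K * dist y z :=
      mul_le_mul_of_nonneg_right (Real.le_coe_toNNReal K) dist_nonneg
    rw [Real.dist_eq, abs_le]
    constructor <;> linarith
  exact this.continuous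

lemma Chart.closure_le (c : Chart r K Ω p h τ) {z : E2} (hz : z ∈ closure Ω) (hd : dist z p < r) :
    h z ≤ 0 := by
  by_contra hc
  push Not at hc
  have hU : IsOpen ({w | 0 < h w} ∩ ball p r) :=
    (isOpen_lt continuous_const c.continuous).inter isOpen_ball
  obtain ⟨w, ⟨hw1, hw2⟩, hw3⟩ := mem_closure_iff.1 hz _ hU ⟨hc, mem_ball.2 hd⟩
  have := (c.mem w (mem_ball.1 hw2)).1 hw3
  have : 0 < h w := hw1
  linarith

lemma Chart.frontier_eq (c : Chart r K Ω p h τ) (ho : IsOpen Ω) {z : E2} (hz : z ∈ frontier Ω)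
    (hd : dist z p < r) : h z = 0 := by
  rw [ho.frontier_eq] at hz
  have h1 := c.closure_le hz.1 hd
  have h2 := (c.mem z hd).not.1 hz.2
  linarith

lemma Chart.mem_closure (c : Chart r K Ω p h τ) {z : E2} (hz : h z ≤ 0)
    (hd : dist z p < r) : z ∈ closure Ω := by
  rw [Metric.mem_closure_iff]
  intro ε hε
  set s := min (ε / 2) ((r - dist z p) / 2)
  have hs : 0 < s := lt_min (by linarith) (by linarith)
  have hs1 : s ≤ ε / 2 := min_le_left _ _
  have hs2 : s ≤ (r - dist z p) / 2 := min_le_right _ _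
  have hm := c.move (-s) z
  rw [abs_neg, abs_of_pos hs] at hm
  refine ⟨τ (-s) z, (c.mem _ ?_).2 ?_, ?_⟩
  · have := dist_triangle (τ (-s) z) z p
    linarith
  · rw [c.up]; linarith
  · rw [dist_comm]; linarith

lemma Chart.mem_frontier (c : Chart r K Ω p h τ) (ho : IsOpen Ω) {z : E2} (hz : h z = 0)
    (hd : dist z p < r) : z ∈ frontier Ω := by
  rw [ho.frontier_eq]
  exact ⟨c.mem_closure hz.le hd, fun hh => by have := (c.mem z hd).1 hh; linarith⟩

/-- Points with large `|h|` are far from the frontier. -/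
lemma Chart.far (c : Chart r K Ω p h τ) (hK : 0 < K) (ho : IsOpen Ω) {y : E2} {δ : ℝ}
    (hy : K * δ ≤ |h y|) (hd : dist y p + δ ≤ r) {z : E2} (hz : z ∈ frontier Ω) :
    δ ≤ dist y z := by
  by_contra hc
  push Not at hc
  have h1 := dist_triangle z y p
  rw [dist_comm z y] at h1
  have h2 := c.frontier_eq ho hz (by linarith)
  have h3 := c.lip y z
  have h4 := c.lip z y
  rw [dist_comm z y] at h4
  have h5 := mul_lt_mul_of_pos_left hc hK
  rcases le_abs.1 hy with h | h <;> linarith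

/-- Points far from the frontier have large `|h|`. -/
lemma Chart.big (c : Chart r K Ω p h τ) (ho : IsOpen Ω) {y : E2} {δ : ℝ}
    (hd : dist y p + δ ≤ r) (hy : ∀ z ∈ frontier Ω, δ ≤ dist y z) : δ ≤ |h y| := by
  by_contra hc
  push Not at hc
  have hm := c.move (-h y) y
  rw [abs_neg] at hm
  have h1 := dist_triangle (τ (-h y) y) y p
  have := hy _ (c.mem_frontier ho (z := τ (-h y) y) (by rw [c.up]; ring) (by linarith))
  rw [dist_comm] at this
  linarith

/-- One side of the frontier: `T` is constant there. (`ε = 1` or `-1`) -/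
lemma Chart.side (c : Chart r K Ω p h τ) (hK : 0 < K) (ho : IsOpen Ω) {T : Set E2} {d ρ ε : ℝ}
    (hε : |ε| = 1) (hρ : 0 < ρ)
    (hT : ∀ z ∈ frontier T, ∃ w ∈ frontier Ω, dist z w < d)
    (hr : ρ + 2 * K * ρ + d ≤ r) {y z : E2} (hy : dist y p < ρ) (hz : dist z p < ρ)
    (hy' : K * d ≤ ε * h y) (hz' : K * d ≤ ε * h z) : y ∈ T ↔ z ∈ T := by
  have hee : ε * ε = 1 := by rw [← abs_mul_abs_self, hε]; norm_num
  have avoid : ∀ w, dist w p < ρ + 2 * K * ρ → K * d ≤ ε * h w → w ∉ frontier T := by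
    intro w hw hw' hf
    obtain ⟨v, hv, hvd⟩ := hT w hf
    have := c.far hK ho (y := w) (δ := d) (hw'.trans ((le_abs_self _).trans (by
      rw [abs_mul, hε, one_mul]))) (by linarith) hv
    linarith
  have vert : ∀ w, dist w p < ρ → K * d ≤ ε * h w → ∀ s ∈ Icc (0 : ℝ) (2 * K * ρ),
      dist (τ (ε * s) w) p < ρ + 2 * K * ρ := by
    intro w hw hw' s hs
    have hm := c.move (ε * s) w
    rw [abs_mul, hε, one_mul, abs_of_nonneg hs.1] at hm
    have := dist_triangle (τ (ε * s) w) w p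
    linarith [hs.2]
  have hM : 0 ≤ 2 * K * ρ := by positivity
  have hup : ∀ w s, ε * h (τ (ε * s) w) = ε * h w + s := by
    intro w s
    rw [c.up, mul_add, ← mul_assoc, hee, one_mul]
  have step : ∀ w, dist w p < ρ → K * d ≤ ε * h w → (w ∈ T ↔ τ (ε * (2 * K * ρ)) w ∈ T) := by
    intro w hw hw'
    have hc : Continuous (fun s => τ (ε * s) w) :=
      (c.cont w).comp (continuous_const.mul continuous_id)
    have hS : IsPreconnected ((fun s => τ (ε * s) w) '' Icc (0 : ℝ) (2 * K * ρ)) :=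
      isPreconnected_Icc.image _ hc.continuousOn
    refine conn_iff hS ?_ ⟨0, ⟨le_rfl, hM⟩, ?_⟩ ⟨_, ⟨hM, le_rfl⟩, rfl⟩
    · rintro _ ⟨s, hs, rfl⟩
      refine avoid _ (vert w hw hw' s hs) ?_
      dsimp only
      rw [hup]; linarith [hs.1]
    · have := c.move 0 w
      simpa using this
  rw [step y hy hy', step z hz hz']
  set M := 2 * K * ρ
  refine conn_iff (S := segment ℝ (τ (ε * M) y) (τ (ε * M) z))
    (convex_segment _ _).isPreconnected ?_ (left_mem_segment ..) (right_mem_segment ..)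
  intro w hw
  have hb := (convex_ball p (ρ + M)).segment_subset
    (mem_ball.2 (vert y hy hy' M ⟨hM, le_rfl⟩)) (mem_ball.2 (vert z hz hz' M ⟨hM, le_rfl⟩)) hw
  refine avoid w hb ?_
  have h1 : dist w (τ (ε * M) y) ≤ dist y z := by
    rw [← c.iso (ε * M) y z]
    have := (convex_closedBall (τ (ε * M) y) (dist (τ (ε * M) y) (τ (ε * M) z))).segment_subset
      (mem_closedBall_self dist_nonneg) (mem_closedBall.2 (dist_comm _ _).le) hw
    exact this
  have h2 : dist y z < 2 * ρ := by
    have := dist_triangle_right y z p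
    linarith
  have h3 : |h (τ (ε * M) y) - h w| ≤ K * dist w (τ (ε * M) y) := by
    have a := c.lip (τ (ε * M) y) w
    have b := c.lip w (τ (ε * M) y)
    rw [dist_comm _ w] at a
    rw [abs_le]; constructor <;> linarith
  have h4 : ε * (h (τ (ε * M) y) - h w) ≤ K * dist w (τ (ε * M) y) := by
    refine (le_abs_self _).trans ?_
    rw [abs_mul, hε, one_mul]; exact h3
  have h5 := hup y M
  have h6 : K * dist w (τ (ε * M) y) ≤ M := by
    have := mul_le_mul_of_nonneg_left (h1.trans h2.le) hK.le
    simp only [M]; linarith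
  linarith

/-- Scales used in the proof. -/
structure Scales (r K d δ s : ℝ) : Prop where
  hK : 1 ≤ K
  hd : 0 < d
  hδ : δ = K * d
  hs : s = K * δ + δ
  hr : s * (6 * K + 4) ≤ r

lemma Scales.facts {d δ s : ℝ} (S : Scales r K d δ s) :
    0 < K ∧ d ≤ δ ∧ δ ≤ K * δ ∧ 0 < s ∧ s ≤ K * s ∧ 3 * s + 2 * K * (3 * s) + d ≤ r ∧ 10 * s ≤ r := by
  obtain ⟨hK, hd, hδ, hs, hr⟩ := S
  have k0 : 0 < K := by linarith
  have a : d ≤ δ := by rw [hδ]; nlinarith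
  have b : δ ≤ K * δ := by nlinarith
  have c : 0 < s := by linarith
  have e : s ≤ K * s := by nlinarith
  refine ⟨k0, a, b, c, e, ?_, ?_⟩ <;> linarith

variable {Ω₁ Ω₂ : Set E2} {d δ s : ℝ}

lemma prop_aux {y1 y2 z1 z2 a1 a2 b1 b2 : Prop} (ya : (y1 ↔ a1) → (y2 ↔ a2))
    (yb : (y1 ↔ b1) → (y2 ↔ b2)) (za : (z1 ↔ a1) → (z2 ↔ a2)) (zb : (z1 ↔ b1) → (z2 ↔ b2))
    (ab : (a1 ↔ b1) → (a2 ↔ b2)) (yz : (y1 ↔ z1) → (y2 ↔ z2)) (ha : ¬ a2) (hb : b2)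
    (hy : y1 ↔ y2) : z1 ↔ z2 := by
  by_cases y1 <;> by_cases z1 <;> by_cases a1 <;> by_cases b1 <;> simp_all

lemma local_dich (S : Scales r K d δ s) (o1 : IsOpen Ω₁) (o2 : IsOpen Ω₂)
    (H1 : ∀ p ∈ frontier Ω₁, ∃ h τ, Chart r K Ω₁ p h τ)
    (H2 : ∀ p ∈ frontier Ω₂, ∃ h τ, Chart r K Ω₂ p h τ)
    (D1 : ∀ z ∈ frontier Ω₁, ∃ w ∈ frontier Ω₂, dist z w < d)
    (D2 : ∀ z ∈ frontier Ω₂, ∃ w ∈ frontier Ω₁, dist z w < d)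
    {p : E2} (hp : p ∈ frontier Ω₁) {y z : E2} (hy : dist y p < 3 * s) (hz : dist z p < 3 * s)
    (fy : ∀ w ∈ frontier Ω₁, δ ≤ dist y w) (fz : ∀ w ∈ frontier Ω₁, δ ≤ dist z w)
    (ay : y ∈ Ω₁ ↔ y ∈ Ω₂) : z ∈ Ω₁ ↔ z ∈ Ω₂ := by
  obtain ⟨k0, f1, f2, f3, f4, f5, f6⟩ := S.facts
  have hδ := S.hδ
  have hs := S.hs
  have hd := S.hd
  obtain ⟨h, τ, c⟩ := H1 p hp
  obtain ⟨q, hq, hpq⟩ := D1 p hp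
  obtain ⟨h', τ', c'⟩ := H2 q hq
  have up : ∀ a b, dist a p < 3 * s → dist b p < 3 * s → (∀ w ∈ frontier Ω₁, δ ≤ dist a w) →
      (∀ w ∈ frontier Ω₁, δ ≤ dist b w) → (a ∈ Ω₁ ↔ b ∈ Ω₁) → (a ∈ Ω₂ ↔ b ∈ Ω₂) := by
    intro a b ha hb fa fb hab
    have ba := c.big o1 (by linarith) fa
    have bb := c.big o1 (by linarith) fb
    rw [c.mem a (by linarith), c.mem b (by linarith)] at hab
    by_cases h0 : h a < 0
    · have h1 := hab.1 h0
      rw [abs_of_neg h0] at ba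
      rw [abs_of_neg h1] at bb
      exact c.side k0 o1 (ε := -1) (by norm_num) (by linarith) D2 f5 ha hb (by linarith) (by linarith)
    · have h1 := hab.not.1 h0
      rw [abs_of_nonneg (not_lt.1 h0)] at ba
      rw [abs_of_nonneg (not_lt.1 h1)] at bb
      exact c.side k0 o1 (ε := 1) (by norm_num) (by linarith) D2 f5 ha hb (by linarith) (by linarith)
  have pt : ∀ ε : ℝ, |ε| = 1 → dist (τ' (ε * s) q) p < 3 * s ∧
      (∀ w ∈ frontier Ω₁, δ ≤ dist (τ' (ε * s) q) w) ∧ (τ' (ε * s) q ∈ Ω₂ ↔ ε * s < 0) := by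
    intro ε hε
    have hm := c'.move (ε * s) q
    have hu := c'.up (ε * s) q
    rw [c'.zero, zero_add] at hu
    have habs : |ε * s| = s := by rw [abs_mul, hε, one_mul, abs_of_pos f3]
    rw [habs] at hm
    refine ⟨?_, ?_, ?_⟩
    · have := dist_triangle (τ' (ε * s) q) q p
      rw [dist_comm q p] at this
      linarith
    · intro w hw
      obtain ⟨v, hv, hvd⟩ := D1 w hw
      have := c'.far k0 o2 (y := τ' (ε * s) q) (δ := δ + d) (by rw [hu, habs]; linarith)
        (by rw [hm]; linarith) hv
      have := dist_triangle (τ' (ε * s) q) w v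
      linarith
    · rw [c'.mem _ (by linarith), hu]
  obtain ⟨a1, a2, a3⟩ := pt 1 (by norm_num)
  obtain ⟨b1, b2, b3⟩ := pt (-1) (by norm_num)
  have a4 : τ' (1 * s) q ∉ Ω₂ := fun hh => by have := a3.1 hh; linarith
  have b4 : τ' (-1 * s) q ∈ Ω₂ := b3.2 (by linarith)
  have ya := up y _ hy a1 fy a2
  have yb := up y _ hy b1 fy b2
  have za := up z _ hz a1 fz a2
  have zb := up z _ hz b1 fz b2
  have ab := up _ _ a1 b1 a2 b2
  exact prop_aux ya yb za zb ab (up y z hy hz fy fz) a4 b4 ay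

lemma agreement (S : Scales r K d δ s) (o1 : IsOpen Ω₁) (o2 : IsOpen Ω₂)
    (H1 : ∀ p ∈ frontier Ω₁, ∃ h τ, Chart r K Ω₁ p h τ)
    (H2 : ∀ p ∈ frontier Ω₂, ∃ h τ, Chart r K Ω₂ p h τ)
    (D1 : ∀ z ∈ frontier Ω₁, ∃ w ∈ frontier Ω₂, dist z w < d)
    (D2 : ∀ z ∈ frontier Ω₂, ∃ w ∈ frontier Ω₁, dist z w < d)
    {R : ℝ} (hR : 0 < R) (B1 : Ω₁ ⊆ ball 0 R) (B2 : Ω₂ ⊆ ball 0 R)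
    {y : E2} (fy : ∀ w ∈ frontier Ω₁, δ ≤ dist y w) : y ∈ Ω₁ ↔ y ∈ Ω₂ := by
  obtain ⟨k0, f1, f2, f3, f4, f5, f6⟩ := S.facts
  have hδ := S.hδ
  have hs := S.hs
  have hd := S.hd
  set F : Set E2 := {y | ∀ w ∈ frontier Ω₁, δ ≤ dist y w} with hF
  set P : Set E2 := {x | ∃ y ∈ F, dist y x < s ∧ (y ∈ Ω₁ ↔ y ∈ Ω₂)} with hP
  set Q : Set E2 := {x | ∃ y ∈ F, dist y x < s ∧ ¬ (y ∈ Ω₁ ↔ y ∈ Ω₂)} with hQ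
  have oP : IsOpen P := by
    have : P = ⋃ y ∈ {y | y ∈ F ∧ (y ∈ Ω₁ ↔ y ∈ Ω₂)}, ball y s := by
      ext x
      simp only [hP, mem_ofPred_eq, mem_iUnion, mem_ball, exists_prop, dist_comm x]
      exact exists_congr fun _ => by tauto
    rw [this]
    exact isOpen_biUnion fun _ _ => isOpen_ball
  have oQ : IsOpen Q := by
    have : Q = ⋃ y ∈ {y | y ∈ F ∧ ¬ (y ∈ Ω₁ ↔ y ∈ Ω₂)}, ball y s := by
      ext x
      simp only [hQ, mem_ofPred_eq, mem_iUnion, mem_ball, exists_prop, dist_comm x]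
      exact exists_congr fun _ => by tauto
    rw [this]
    exact isOpen_biUnion fun _ _ => isOpen_ball
  have cover : (univ : Set E2) ⊆ P ∪ Q := by
    intro x _
    have : ∃ y ∈ F, dist y x < s := by
      by_cases hx : x ∈ F
      · exact ⟨x, hx, by simpa using f3⟩
      · simp only [hF, mem_ofPred_eq, not_forall, not_le] at hx
        obtain ⟨p, hp, hpx⟩ := hx
        obtain ⟨h, τ, c⟩ := H1 p hp
        have hm := c.move (K * δ) p
        have hu := c.up (K * δ) p
        rw [c.zero, zero_add] at hu
        rw [abs_of_pos (by linarith)] at hm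
        refine ⟨τ (K * δ) p, ?_, ?_⟩
        · intro w hw
          exact c.far k0 o1 (by rw [hu]; exact le_abs_self _) (by rw [hm]; linarith) hw
        · have := dist_triangle (τ (K * δ) p) p x
          rw [dist_comm p x] at this
          linarith
    obtain ⟨y, hy, hyx⟩ := this
    by_cases hh : y ∈ Ω₁ ↔ y ∈ Ω₂
    · exact Or.inl ⟨y, hy, hyx, hh⟩
    · exact Or.inr ⟨y, hy, hyx, hh⟩
  have inf : P.Nonempty := by
    let x : E2 := EuclideanSpace.single 0 (R + δ)
    have hx : ‖x‖ = R + δ := by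
      simp only [x, PiLp.norm_single, Real.norm_eq_abs]
      exact abs_of_pos (by linarith)
    have n1 : x ∉ Ω₁ := fun hh => by
      have := mem_ball_zero_iff.1 (B1 hh); linarith
    have n2 : x ∉ Ω₂ := fun hh => by
      have := mem_ball_zero_iff.1 (B2 hh); linarith
    refine ⟨x, x, ?_, by simpa using f3, by tauto⟩
    intro w hw
    have h1 : w ∈ closedBall (0 : E2) R :=
      closure_minimal (B1.trans ball_subset_closedBall) isClosed_closedBall (frontier_subset_closure hw)
    have h2 := mem_closedBall_zero_iff.1 h1
    have h3 := norm_sub_norm_le x w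
    rw [← dist_eq_norm] at h3
    linarith
  by_contra hcon
  have neQ : Q.Nonempty := ⟨y, y, fy, by simpa using f3, hcon⟩
  obtain ⟨x, -, ⟨a, ha, hax, haa⟩, b, hb, hbx, hbb⟩ := isPreconnected_univ P Q oP oQ cover
    (by simpa using inf) (by simpa using neQ)
  by_cases hp : ∃ p ∈ frontier Ω₁, dist x p < 2 * s
  · obtain ⟨p, hp, hpx⟩ := hp
    have t1 := dist_triangle a x p
    have t2 := dist_triangle b x p
    exact hbb (local_dich S o1 o2 H1 H2 D1 D2 hp (by linarith) (by linarith) ha hb haa)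
  · push Not at hp
    have e1 : a ∈ Ω₁ ↔ b ∈ Ω₁ := by
      refine conn_iff (convex_ball x s).isPreconnected ?_ (mem_ball.2 hax) (mem_ball.2 hbx)
      intro w hw hf
      have := hp w hf
      rw [mem_ball, dist_comm] at hw
      linarith
    have e2 : a ∈ Ω₂ ↔ b ∈ Ω₂ := by
      refine conn_iff (convex_ball x s).isPreconnected ?_ (mem_ball.2 hax) (mem_ball.2 hbx)
      intro w hw hf
      obtain ⟨v, hv, hvd⟩ := D2 w hf
      have := hp v hv
      rw [mem_ball, dist_comm] at hw
      have := dist_triangle x w v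
      linarith
    tauto

/-- First half: closures are at least as close as frontiers. -/
lemma closure_close (S : Scales r K d δ s) (o1 : IsOpen Ω₁) (o2 : IsOpen Ω₂)
    (H1 : ∀ p ∈ frontier Ω₁, ∃ h τ, Chart r K Ω₁ p h τ)
    (H2 : ∀ p ∈ frontier Ω₂, ∃ h τ, Chart r K Ω₂ p h τ) {D : ℝ} (hD : 0 ≤ D) (hDd : D < d)
    (D1 : ∀ z ∈ frontier Ω₁, ∃ w ∈ frontier Ω₂, dist z w ≤ D)
    (D2 : ∀ z ∈ frontier Ω₂, ∃ w ∈ frontier Ω₁, dist z w ≤ D)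
    {R : ℝ} (hR : 0 < R) (B1 : Ω₁ ⊆ ball 0 R) (B2 : Ω₂ ⊆ ball 0 R)
    {x : E2} (hx : x ∈ closure Ω₁) : ∃ w ∈ closure Ω₂, dist x w ≤ D := by
  obtain ⟨k0, f1, f2, f3, f4, f5, f6⟩ := S.facts
  have hδ := S.hδ
  have hs := S.hs
  have hd := S.hd
  have D1' : ∀ z ∈ frontier Ω₁, ∃ w ∈ frontier Ω₂, dist z w < d := fun z hz =>
    (D1 z hz).imp fun w hw => ⟨hw.1, hw.2.trans_lt hDd⟩
  have D2' : ∀ z ∈ frontier Ω₂, ∃ w ∈ frontier Ω₁, dist z w < d := fun z hz =>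
    (D2 z hz).imp fun w hw => ⟨hw.1, hw.2.trans_lt hDd⟩
  have agr : ∀ y, (∀ w ∈ frontier Ω₂, δ ≤ dist y w) → (y ∈ Ω₂ ↔ y ∈ Ω₁) := fun y fy =>
    agreement S o2 o1 H2 H1 D2' D1' hR B2 B1 fy
  by_cases x1 : x ∈ Ω₁
  swap
  · obtain ⟨w, hw, hwd⟩ := D1 x (by rw [o1.frontier_eq]; exact ⟨hx, x1⟩)
    exact ⟨w, frontier_subset_closure hw, hwd⟩
  by_cases x2 : x ∈ Ω₂
  · exact ⟨x, subset_closure x2, by simpa using hD⟩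
  have hq : ∃ q ∈ frontier Ω₂, dist x q < δ := by
    by_contra hc
    push Not at hc
    exact x2 ((agr x hc).2 x1)
  obtain ⟨q, hq, hxq⟩ := hq
  obtain ⟨h, τ, c⟩ := H2 q hq
  have hx0 : 0 ≤ h x := not_lt.1 ((c.mem x (by linarith)).not.1 x2)
  have hm : ∀ σ ∈ Icc (0 : ℝ) (K * δ), dist (τ σ x) q < s := by
    intro σ hσ
    have := c.move σ x
    rw [abs_of_nonneg hσ.1] at this
    have := dist_triangle (τ σ x) x q
    linarith [hσ.2]
  have hKδ : 0 ≤ K * δ := by linarith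
  have hend : τ (K * δ) x ∉ Ω₁ := by
    have hb := hm (K * δ) ⟨hKδ, le_rfl⟩
    have hu := c.up (K * δ) x
    rw [← agr, c.mem _ (by linarith)]
    · linarith
    · intro w hw
      exact c.far k0 o2 (le_trans (by linarith) (le_abs_self _)) (by linarith) hw
  have hcross : ∃ σ ∈ Icc (0 : ℝ) (K * δ), τ σ x ∈ frontier Ω₁ := by
    by_contra hc
    push Not at hc
    have hS : IsPreconnected ((fun σ => τ σ x) '' Icc (0 : ℝ) (K * δ)) :=
      isPreconnected_Icc.image _ (c.cont x).continuousOn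
    have h0 : τ 0 x = x := by
      have := c.move 0 x
      simpa using this
    refine hend ((conn_iff hS ?_ ⟨0, ⟨le_rfl, hKδ⟩, h0⟩ ⟨_, ⟨hKδ, le_rfl⟩, rfl⟩).1 x1)
    rintro _ ⟨σ, hσ, rfl⟩
    exact hc σ hσ
  obtain ⟨σ, hσ, hf⟩ := hcross
  obtain ⟨v, hv, hvd⟩ := D1 _ hf
  have hb := hm σ hσ
  have t1 := dist_triangle v (τ σ x) q
  rw [dist_comm v (τ σ x)] at t1
  have hv0 := c.frontier_eq o2 hv (by linarith)
  have m2 := c.move (-σ) v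
  rw [abs_neg, abs_of_nonneg hσ.1] at m2
  have t2 := dist_triangle (τ (-σ) v) v q
  refine ⟨τ (-σ) v, c.mem_closure ?_ ?_, ?_⟩
  · rw [c.up]; linarith [hσ.1]
  · linarith [hσ.2]
  · have := c.iso (-σ) (τ σ x) v
    rw [c.inv] at this
    linarith

/-- Second half. -/
lemma frontier_close (hK : 1 ≤ K)
    (H1 : ∀ p ∈ frontier Ω₁, ∃ h τ, Chart r K Ω₁ p h τ) {D t : ℝ} (hD : 0 ≤ D)
    (ht : K * D < t) (htr : t + D < r)
    (D1 : ∀ z ∈ closure Ω₁, ∃ w ∈ closure Ω₂, dist z w ≤ D)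
    (D2 : ∀ z ∈ closure Ω₂, ∃ w ∈ closure Ω₁, dist z w ≤ D)
    {p : E2} (hp : p ∈ frontier Ω₁) : ∃ q ∈ frontier Ω₂, dist p q ≤ t := by
  have hDt : D < t := by nlinarith
  obtain ⟨h, τ, c⟩ := H1 p hp
  obtain ⟨b, hb, hpb⟩ := D1 p (frontier_subset_closure hp)
  have hm := c.move t p
  have hu := c.up t p
  rw [abs_of_pos (by linarith)] at hm
  rw [c.zero, zero_add] at hu
  have ha : τ t p ∉ closure Ω₂ := by
    intro hc
    obtain ⟨w, hw, hwd⟩ := D2 _ hc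
    have t1 := dist_triangle w (τ t p) p
    rw [dist_comm w (τ t p)] at t1
    have h1 := c.closure_le hw (by linarith)
    have h2 := c.lip (τ t p) w
    have h3 := mul_le_mul_of_nonneg_left hwd (by linarith : (0 : ℝ) ≤ K)
    linarith
  by_contra hc
  push Not at hc
  refine ha ((conn_iff (T := closure Ω₂) (convex_closedBall p t).isPreconnected ?_
    (y := b) ?_ ?_).1 hb)
  · intro w hw hf
    have := hc w (frontier_closure_subset hf)
    rw [mem_closedBall, dist_comm] at hw
    linarith
  · rw [mem_closedBall, dist_comm]; linarith
  · rw [mem_closedBall]; linarith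

lemma haus_attained {s t : Set E2} (hs : IsCompact s) (ht : IsCompact t) (ns : s.Nonempty)
    (nt : t.Nonempty) {x : E2} (hx : x ∈ s) : ∃ y ∈ t, dist x y ≤ hausdorffDist s t := by
  obtain ⟨y, hy, e⟩ := ht.exists_infDist_eq_dist nt x
  exact ⟨y, hy, e ▸ infDist_le_hausdorffDist_of_mem hx
    (hausdorffEDist_ne_top_of_nonempty_of_bounded ns nt hs.isBounded ht.isBounded)⟩

end helpers

theorem stmt3 (L : ℝ) (hL : 0 < L) :
    ∃ c₁ C : ℝ, 0 < c₁ ∧ c₁ ≤ 1 ∧ 1 ≤ C ∧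
      ∀ r R : ℝ, 0 < r → 0 < R →
      ∀ Ω₁ Ω₂ : Set E2, IsOpen Ω₁ → IsOpen Ω₂ → Ω₁.Nonempty → Ω₂.Nonempty →
        Ω₁ ⊆ ball 0 R → Ω₂ ⊆ ball 0 R →
        IsLipDomain r L Ω₁ → IsLipDomain r L Ω₂ →
        (hausdorffDist (closure Ω₁) (closure Ω₂) ≤ c₁ * r ∨
          hausdorffDist (frontier Ω₁) (frontier Ω₂) ≤ c₁ * r) →
        hausdorffDist (closure Ω₁) (closure Ω₂) ≤
            hausdorffDist (frontier Ω₁) (frontier Ω₂) ∧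
          hausdorffDist (frontier Ω₁) (frontier Ω₂) ≤
            C * hausdorffDist (closure Ω₁) (closure Ω₂) := by
  set K := 1 + L with hKdef
  have hK : 1 ≤ K := by linarith
  have k0 : 0 < K := by linarith
  set N := (K * K + K) * (6 * K + 4) with hN
  have hKK : 1 ≤ K * K + K := by nlinarith
  have hN10 : 10 * K ≤ N := by
    have h1 : (K * K + K) * 10 ≤ (K * K + K) * (6 * K + 4) :=
      mul_le_mul_of_nonneg_left (by linarith) (by linarith)
    nlinarith
  have hN0 : 0 < N := by linarith
  have hNK : 0 < 2 * N * K := by positivity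
  refine ⟨1 / (2 * N * K), K, by positivity, ?_, hK, ?_⟩
  · rw [div_le_one hNK]; nlinarith
  intro r R hr hR Ω₁ Ω₂ o1 o2 n1 n2 B1 B2 L1 L2 hyp
  have cc : ∀ Ω : Set E2, Ω ⊆ ball 0 R → IsCompact (closure Ω) := fun Ω hB =>
    (isBounded_ball.subset hB).isCompact_closure
  have cf : ∀ Ω : Set E2, Ω ⊆ ball 0 R → IsCompact (frontier Ω) := fun Ω hB =>
    (cc Ω hB).of_isClosed_subset isClosed_frontier frontier_subset_closure
  have nf : ∀ Ω : Set E2, Ω ⊆ ball 0 R → Ω.Nonempty → (frontier Ω).Nonempty := by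
    intro Ω hB hn
    rw [nonempty_frontier_iff]
    refine ⟨hn, ?_⟩
    rintro rfl
    have hx : (EuclideanSpace.single 0 R : E2) ∈ ball (0 : E2) R := hB (mem_univ _)
    rw [mem_ball_zero_iff] at hx
    simp [abs_of_pos hR] at hx
  have H1 : ∀ p ∈ frontier Ω₁, ∃ h τ, Chart r K Ω₁ p h τ := fun p hp => exists_chart hL L1 hp
  have H2 : ∀ p ∈ frontier Ω₂, ∃ h τ, Chart r K Ω₂ p h τ := fun p hp => exists_chart hL L2 hp
  set D := hausdorffDist (closure Ω₁) (closure Ω₂) with hD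
  set D' := hausdorffDist (frontier Ω₁) (frontier Ω₂) with hD'
  have D0 : 0 ≤ D := hausdorffDist_nonneg
  have D0' : 0 ≤ D' := hausdorffDist_nonneg
  have E1 : ∀ z ∈ closure Ω₁, ∃ w ∈ closure Ω₂, dist z w ≤ D := fun z hz =>
    haus_attained (cc _ B1) (cc _ B2) n1.closure n2.closure hz
  have E2' : ∀ z ∈ closure Ω₂, ∃ w ∈ closure Ω₁, dist z w ≤ D := fun z hz => by
    rw [hD, hausdorffDist_comm]
    exact haus_attained (cc _ B2) (cc _ B1) n2.closure n1.closure hz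
  have F1 : ∀ z ∈ frontier Ω₁, ∃ w ∈ frontier Ω₂, dist z w ≤ D' := fun z hz =>
    haus_attained (cf _ B1) (cf _ B2) (nf _ B1 n1) (nf _ B2 n2) hz
  have F2 : ∀ z ∈ frontier Ω₂, ∃ w ∈ frontier Ω₁, dist z w ≤ D' := fun z hz => by
    rw [hD', hausdorffDist_comm]
    exact haus_attained (cf _ B2) (cf _ B1) (nf _ B2 n2) (nf _ B1 n1) hz
  have first : D' ≤ r / (2 * N) → D ≤ D' := by
    intro hle
    have hlt : D' < r / N := by
      refine hle.trans_lt ?_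
      exact div_lt_div_of_pos_left hr hN0 (by linarith)
    have S : Scales r K (r / N) (K * (r / N)) (K * (K * (r / N)) + K * (r / N)) := by
      refine ⟨hK, by positivity, rfl, rfl, le_of_eq ?_⟩
      calc _ = N * (r / N) := by rw [hN]; ring
        _ = r := mul_div_cancel₀ r hN0.ne'
    exact hausdorffDist_le_of_mem_dist D0'
      (fun x hx => closure_close S o1 o2 H1 H2 D0' hlt F1 F2 hR B1 B2 hx)
      (fun x hx => closure_close S o2 o1 H2 H1 D0' hlt F2 F1 hR B2 B1 hx)
  have second : D ≤ r / (2 * N) → D' ≤ K * D := by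
    intro hle
    have hle2 : 20 * K * D ≤ r := by
      rw [le_div_iff₀ (by positivity)] at hle
      nlinarith
    have hDK : D ≤ K * D := by nlinarith
    refine le_of_forall_gt_imp_ge_of_dense fun t ht => ?_
    set t' := min t (K * D + r / 2)
    have ht1 : K * D < t' := lt_min ht (by linarith)
    have ht2 : t' ≤ K * D + r / 2 := min_le_right _ _
    have ht3 : t' + D < r := by nlinarith
    refine le_trans ?_ (min_le_left t (K * D + r / 2))
    exact hausdorffDist_le_of_mem_dist (by linarith)
      (fun x hx => frontier_close hK H1 D0 ht1 ht3 E1 E2' hx)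
      (fun x hx => frontier_close hK H2 D0 ht1 ht3 E2' E1 hx)
  have hc : K * (1 / (2 * N * K) * r) = r / (2 * N) := by field_simp
  have hc0 : 0 ≤ 1 / (2 * N * K) * r := by positivity
  have hc1 : 1 / (2 * N * K) * r ≤ r / (2 * N) := by rw [← hc]; nlinarith
  rcases hyp with hy | hy
  · have h2 := second (hy.trans hc1)
    have h3 : K * D ≤ r / (2 * N) := by
      rw [← hc]; exact mul_le_mul_of_nonneg_left hy k0.le
    exact ⟨first (h2.trans h3), h2⟩
  · have h1 := first (hy.trans hc1)
    exact ⟨h1, second (h1.trans (hy.trans hc1))⟩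
end
end
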